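/- For every non-superreflexive Banach space X there exists a constant D ≥ 1 such that for every integer n ≥ 2 the lamplighter group G_n = Z_2 ≀ Z_n, equipped with the word metric ρ with respect to the generating set S = {t, ta}, admits a bilipschitz embedding into X with distortion at most D. -/

import Mathlib

open scoped symmDiff

/-- Elements of the lamplighter group `Z₂ ≀ Z_n`: a set of lit lamps and a position. -/
abbrev Lamp (n : ℕ) := Set (ZMod n) × ZMod n

/-- Group multiplication `(x,g)·(y,h) = (x △ (g+y), g+h)`. -/
def lampMul {n : ℕ} (u v : Lamp n) : Lamp n :=
  (u.1 ∆ ((u.2 + ·) '' v.1), u.2 + v.2)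

/-- Group inverse in the lamplighter group. -/
def lampInv {n : ℕ} (u : Lamp n) : Lamp n :=
  ((· - u.2) '' u.1, -u.2)

/-- The generator `t = (∅, 1)`. -/
def lampT (n : ℕ) : Lamp n := (∅, 1)

/-- The generator `a = ({0}, 0)`. -/
def lampA (n : ℕ) : Lamp n := ({0}, 0)

/-- The generator `ta`. -/
def lampTA (n : ℕ) : Lamp n := lampMul (lampT n) (lampA n)

/-- Word metric w.r.t. a generating set `S`: the least `m` such that `u⁻¹v`
is a product of `m` elements of `S ∪ S⁻¹`, i.e. `v = u·s₁⋯s_m`. -/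
noncomputable def wordDist {n : ℕ} (S : Set (Lamp n)) (u v : Lamp n) : ℕ :=
  sInf {m | ∃ w : List (Lamp n), w.length = m ∧
    (∀ s ∈ w, s ∈ S ∨ ∃ g ∈ S, s = lampInv g) ∧ v = w.foldl lampMul u}

/-- The word metric `ρ` on `Z₂ ≀ Z_n` w.r.t. the generating set `{t, ta}`. -/
noncomputable def lampDist (n : ℕ) (u v : Lamp n) : ℕ :=
  wordDist {lampT n, lampTA n} u v

/-- Length of the longest common prefix of two vertices of the binary tree. -/
def lgc : List Bool → List Bool → ℕ
  | a :: as, b :: bs => if a = b then lgc as bs + 1 else 0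
  | _, _ => 0

/-- Graph distance in the binary tree (vertices = `{0,1}`-sequences). -/
def treeDist (A B : List Bool) : ℕ := A.length + B.length - 2 * lgc A B

/-- The arc `{a, a+1, ..., a+m}` in `Z_n`. -/
def arcSet (n : ℕ) (a : ZMod n) (m : ℕ) : Set (ZMod n) :=
  {z | ∃ i ≤ m, z = a + (i : ZMod n)}

/-- The arc `P₁ = {n/6, ..., 5n/6}` of `Z_n` (identified with `{0,...,n-1}` via `val`). -/
def P1set (n : ℕ) : Set (ZMod n) := {z | n / 6 ≤ z.val ∧ z.val ≤ 5 * n / 6}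

/-- The subset `P_{1,n} = {(x,k) ∈ G_n : k ∈ P₁}`. -/
def lampP1 (n : ℕ) : Set (Lamp n) := {u | u.2 ∈ P1set n}

/-- The set `W_n ⊆ T_n × T_n`. -/
def Wset (n : ℕ) : Set (List Bool × List Bool) :=
  {p | p.1.length + p.2.length = n ∧ n / 6 ≤ p.1.length ∧ p.1.length ≤ 5 * n / 6}

open Classical in
/-- The map `φ_{1,n} : P_{1,n} → W_n`. -/
noncomputable def phi1 (n : ℕ) (u : Lamp n) : List Bool × List Bool :=
  ((List.range u.2.val).map fun j => if ((j : ℕ) : ZMod n) ∈ u.1 then true else false,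
   (List.range (n - u.2.val)).map fun i => if ((n - 1 - i : ℕ) : ZMod n) ∈ u.1 then true else false)

/-- "X admits an equivalent uniformly convex norm" (= superreflexivity, by Enflo). -/
def HasEquivUnifConvexNorm (X : Type*) [NormedAddCommGroup X] [NormedSpace ℝ X] : Prop :=
  ∃ N : X → ℝ,
    (∀ x, N x = 0 ↔ x = 0) ∧
    (∀ (c : ℝ) (x : X), N (c • x) = |c| * N x) ∧
    (∀ x y, N (x + y) ≤ N x + N y) ∧
    (∃ c₁ > (0 : ℝ), ∃ c₂ > (0 : ℝ), ∀ x, c₁ * ‖x‖ ≤ N x ∧ N x ≤ c₂ * ‖x‖) ∧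
    (∀ ε > (0 : ℝ), ∃ δ > (0 : ℝ), ∀ x y,
      N x ≤ 1 → N y ≤ 1 → ε ≤ N (x - y) → N (x + y) ≤ 2 - δ)

theorem hasEquiv_of_F (X : Type*) [NormedAddCommGroup X] [NormedSpace ℝ X] (F : X → ℝ)
    (h1 : ∀ x, ‖x‖ ≤ F x) (h2 : ∀ x, F x ≤ 2 * ‖x‖) (hneg : ∀ x, F (-x) = F x)
    (hconv : ∀ x y (a b : ℝ), 0 ≤ a → 0 ≤ b → a + b = 1 → F (a • x + b • y) ≤ a * F x + b * F y)
    (hlip : ∀ x y, F x ≤ F y + 2 * ‖x - y‖)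
    (huc : ∀ ε > (0:ℝ), ∃ κ > (0:ℝ), ∀ x y, F x ≤ 1 → F y ≤ 1 → ε ≤ ‖x - y‖ →
      F ((1/2:ℝ) • (x + y)) ≤ 1 - κ) : HasEquivUnifConvexNorm X := by
  set C : Set X := {x | F x ≤ 1} with hC
  have hcont : Continuous F := by
    have : LipschitzWith 2 F := by
      apply LipschitzWith.of_le_add_mul
      intro x y
      rw [dist_eq_norm]
      exact_mod_cast hlip x y
    exact this.continuous
  have hclosed : IsClosed C := isClosed_le hcont continuous_const
  have hCconv : Convex ℝ C := by
    intro x hx y hy a b ha hb hab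
    have := hconv x y a b ha hb hab
    simp only [hC, Set.mem_ofPred_eq] at *
    nlinarith
  have hball : Metric.closedBall (0:X) (1/2) ⊆ C := by
    intro x hx
    simp only [hC, Set.mem_ofPred_eq]
    have := h2 x
    rw [mem_closedBall_zero_iff] at hx
    linarith
  have hball2 : C ⊆ Metric.closedBall (0:X) 1 := by
    intro x hx
    rw [mem_closedBall_zero_iff]
    exact (h1 x).trans hx
  have hnhds : C ∈ nhds (0:X) :=
    Filter.mem_of_superset (Metric.closedBall_mem_nhds _ (by norm_num)) hball
  have habs : Absorbent ℝ C := absorbent_nhds_zero hnhds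
  have hle : ∀ x, gauge C x ≤ 1 ↔ F x ≤ 1 := by
    intro x
    rw [gauge_le_one_iff_mem_closure hCconv hnhds, hclosed.closure_eq]
    rfl
  have hlow : ∀ x, ‖x‖ ≤ gauge C x := by
    intro x
    have := le_gauge_of_subset_closedBall (x := x) habs zero_le_one hball2
    simpa using this
  have hupp : ∀ x, gauge C x ≤ 2 * ‖x‖ := by
    intro x
    have := gauge_mono (absorbent_nhds_zero (Metric.closedBall_mem_nhds (0:X) (by norm_num : (0:ℝ) < 1/2))) hball x
    rw [gauge_closedBall (by norm_num)] at this
    linarith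
  have hsm : ∀ (c : ℝ) x, gauge C (c • x) = |c| * gauge C x := by
    intro c x
    rcases le_total 0 c with hc | hc
    · rw [gauge_smul_of_nonneg hc, abs_of_nonneg hc, smul_eq_mul]
    · have hs : ∀ x ∈ C, -x ∈ C := fun x hx => by
        simp only [hC, Set.mem_ofPred_eq] at *
        rwa [hneg]
      rw [← gauge_neg hs, ← neg_smul, gauge_smul_of_nonneg (neg_nonneg.2 hc), abs_of_nonpos hc,
        smul_eq_mul]
  refine ⟨gauge C, ?_, hsm, gauge_add_le hCconv habs, ⟨1, one_pos, 2, two_pos, fun x => ⟨by linarith [hlow x], hupp x⟩⟩, ?_⟩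
  · intro x
    constructor
    · intro h
      have := hlow x
      rw [h] at this
      exact norm_le_zero_iff.1 this
    · rintro rfl
      exact gauge_zero
  · intro ε hε
    obtain ⟨κ, hκ, H⟩ := huc (ε/2) (by linarith)
    have hpos : 0 < 1 + κ/2 := by linarith
    refine ⟨2 - 2/(1+κ/2), ?_, ?_⟩
    · rw [gt_iff_lt, sub_pos, div_lt_iff₀ hpos]
      linarith
    · intro x y hx hy hxy
      have hd : ε/2 ≤ ‖x - y‖ := by
        have := hupp (x-y)
        linarith
      have hm := H x y ((hle x).1 hx) ((hle y).1 hy) hd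
      set m := (1/2:ℝ) • (x+y) with hmdef
      have hm1 : ‖m‖ ≤ 1 := (h1 m).trans (by linarith)
      have h3 : F ((1+κ/2) • m) ≤ 1 := by
        have := hlip ((1+κ/2) • m) m
        have e : (1+κ/2) • m - m = (κ/2) • m := by
          rw [add_smul, one_smul]; abel
        rw [e, norm_smul, Real.norm_of_nonneg (by linarith)] at this
        nlinarith
      have h4 := (hle _).2 h3
      rw [hsm, abs_of_pos hpos] at h4
      have h5 : gauge C (x+y) = 2 * gauge C m := by
        rw [hmdef, hsm, abs_of_pos (by norm_num)]; ring
      have h6 : gauge C m ≤ 1/(1+κ/2) := by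
        rw [le_div_iff₀ hpos]; linarith
      rw [h5]
      have : 2/(1+κ/2) = 2 * (1/(1+κ/2)) := by ring
      linarith

/-- Iterated "far midpoint" derivation of the unit ball. -/
def Bder (X : Type*) [NormedAddCommGroup X] [NormedSpace ℝ X] (ε : ℝ) : ℕ → Set X
  | 0 => Metric.closedBall 0 1
  | k+1 => convexHull ℝ {m | ∃ x ∈ Bder X ε k, ∃ y ∈ Bder X ε k, ε ≤ ‖x - y‖ ∧ m = (1/2:ℝ) • (x + y)}

section
variable {X : Type*} [NormedAddCommGroup X] [NormedSpace ℝ X]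

theorem Bder_convex (ε : ℝ) (k : ℕ) : Convex ℝ (Bder X ε k) := by
  cases k with
  | zero => exact convex_closedBall _ _
  | succ k => exact convex_convexHull _ _

theorem Bder_neg (ε : ℝ) (k : ℕ) : ∀ x ∈ Bder X ε k, -x ∈ Bder X ε k := by
  induction k with
  | zero => intro x hx; simpa [Bder] using hx
  | succ k ih =>
    intro x hx
    have : Bder X ε (k+1) ⊆ -Bder X ε (k+1) := by
      apply convexHull_min
      · rintro m ⟨x, hx, y, hy, hxy, rfl⟩
        rw [Set.mem_neg]
        apply subset_convexHull
        refine ⟨-x, ih x hx, -y, ih y hy, ?_, by simp [smul_add, add_comm]⟩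
        rw [show -x - -y = -(x - y) by abel, norm_neg]; exact hxy
      · exact (Bder_convex ε (k+1)).neg
    exact this hx

theorem Bder_zero_mem (ε : ℝ) (k : ℕ) (h : (Bder X ε k).Nonempty) : (0:X) ∈ Bder X ε k := by
  obtain ⟨x, hx⟩ := h
  have := Bder_convex ε k hx (Bder_neg ε k x hx) (by norm_num : (0:ℝ) ≤ 1/2) (by norm_num : (0:ℝ) ≤ 1/2) (by norm_num)
  simpa using this

theorem Bder_mid {ε : ℝ} {k : ℕ} {x y : X} (hx : x ∈ Bder X ε k) (hy : y ∈ Bder X ε k) (h : ε ≤ ‖x - y‖) :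
    (1/2:ℝ) • (x + y) ∈ Bder X ε (k+1) :=
  subset_convexHull _ _ ⟨x, hx, y, hy, h, rfl⟩

theorem Bder_succ_subset (ε : ℝ) (k : ℕ) : Bder X ε (k+1) ⊆ Bder X ε k := by
  apply convexHull_min _ (Bder_convex ε k)
  rintro m ⟨x, hx, y, hy, hxy, rfl⟩
  have := Bder_convex ε k hx hy (by norm_num : (0:ℝ) ≤ 1/2) (by norm_num : (0:ℝ) ≤ 1/2) (by norm_num)
  rwa [← smul_add] at this

theorem Bder_norm_le (ε : ℝ) (k : ℕ) : ∀ x ∈ Bder X ε k, ‖x‖ ≤ 1 := by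
  induction k with
  | zero => intro x hx; simpa [Bder] using hx
  | succ k ih => intro x hx; exact ih x (Bder_succ_subset ε k hx)

theorem infDist_conv {s : Set X} (hs : Convex ℝ s) (hne : s.Nonempty) (x y : X) (a b : ℝ) (ha : 0 ≤ a)
    (hb : 0 ≤ b) (hab : a + b = 1) :
    Metric.infDist (a • x + b • y) s ≤ a * Metric.infDist x s + b * Metric.infDist y s := by
  apply le_of_forall_pos_le_add
  intro e he
  obtain ⟨x', hx', hdx⟩ := (Metric.infDist_lt_iff hne).1 (lt_add_of_pos_right (Metric.infDist x s) he)
  obtain ⟨y', hy', hdy⟩ := (Metric.infDist_lt_iff hne).1 (lt_add_of_pos_right (Metric.infDist y s) he)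
  have h1 := Metric.infDist_le_dist_of_mem (x := a • x + b • y) (hs hx' hy' ha hb hab)
  have h2 : dist (a • x + b • y) (a • x' + b • y') ≤ a * dist x x' + b * dist y y' := by
    refine (dist_add_add_le _ _ _ _).trans ?_
    rw [dist_smul₀, dist_smul₀, Real.norm_of_nonneg ha, Real.norm_of_nonneg hb]
  have h3 := mul_le_mul_of_nonneg_left hdx.le ha
  have h4 := mul_le_mul_of_nonneg_left hdy.le hb
  have h5 : a * e + b * e = e := by rw [← add_mul, hab, one_mul]
  linarith

theorem mid_infDist {s : Set X} (hs : Convex ℝ s) (hne : s.Nonempty) (x y : X) :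
    Metric.infDist ((1/2:ℝ) • (x + y)) s ≤ (Metric.infDist x s + Metric.infDist y s)/2 := by
  have := infDist_conv hs hne x y (1/2) (1/2) (by norm_num) (by norm_num) (by norm_num)
  rw [smul_add]; linarith

theorem gain_lemma {e : ℝ} (he : 0 < e) {n : ℕ} (hne : ∀ k < n, (Bder X e k).Nonempty)
    (hemp : Bder X e n = ∅) : ∃ η > (0:ℝ), ∀ x y : X, ‖x‖ ≤ 1 → ‖y‖ ≤ 1 → 2 * e ≤ ‖x - y‖ →
      ∑ k ∈ Finset.range n, Metric.infDist ((1/2:ℝ) • (x + y)) (Bder X e k) ≤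
      (∑ k ∈ Finset.range n, Metric.infDist x (Bder X e k) +
       ∑ k ∈ Finset.range n, Metric.infDist y (Bder X e k))/2 - η := by
  have hn : 0 < n := by
    rcases Nat.eq_zero_or_pos n with h | h
    · subst h
      exfalso
      have : (0:X) ∈ Bder X e 0 := by simp [Bder]
      rw [hemp] at this
      exact this
    · exact h
  set η := e / (2 * 4^n) with hη
  have hηpos : 0 < η := by positivity
  have hbound : ∀ k ≤ n, η * 4^k ≤ e/2 := by
    intro k hk
    have : (4:ℝ)^k ≤ 4^n := pow_le_pow_right₀ (by norm_num) hk
    rw [hη, div_mul_eq_mul_div, div_le_div_iff₀ (by positivity) (by norm_num)]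
    nlinarith
  refine ⟨η, hηpos, fun x y hx hy hxy => ?_⟩
  let P : ℕ → Prop := fun k => k < n ∧ Metric.infDist x (Bder X e k) < η * 4^k ∧ Metric.infDist y (Bder X e k) < η * 4^k
  have hP0 : P 0 := by
    refine ⟨hn, ?_, ?_⟩
    · rw [Metric.infDist_zero_of_mem (by simpa [Bder] using hx)]; positivity
    · rw [Metric.infDist_zero_of_mem (by simpa [Bder] using hy)]; positivity
  have hex : ∃ k, P k ∧ ¬ P (k+1) := by
    by_contra hcon
    push Not at hcon
    have : ∀ k, P k := fun k => Nat.rec hP0 (fun k ih => hcon k ih) k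
    exact absurd (this n).1 (lt_irrefl _)
  obtain ⟨k, ⟨hkn, hkx, hky⟩, hk1⟩ := hex
  obtain ⟨x', hx', hdx⟩ := (Metric.infDist_lt_iff (hne k hkn)).1 hkx
  obtain ⟨y', hy', hdy⟩ := (Metric.infDist_lt_iff (hne k hkn)).1 hky
  have hfar : e ≤ ‖x' - y'‖ := by
    have h1 : ‖x - y‖ ≤ ‖x - x'‖ + ‖x' - y'‖ + ‖y - y'‖ := by
      have : x - y = (x - x') + (x' - y') + (y' - y) := by abel
      rw [this]
      refine (norm_add₃_le).trans ?_
      rw [norm_sub_rev y' y]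
    rw [dist_eq_norm] at hdx hdy
    have := hbound k hkn.le
    linarith
  have hmem := Bder_mid hx' hy' hfar
  have hk1n : k + 1 < n := by
    by_contra hcon
    have : k + 1 = n := by omega
    rw [this, hemp] at hmem
    exact hmem
  have hmd : Metric.infDist ((1/2:ℝ) • (x + y)) (Bder X e (k+1)) ≤ η * 4^k := by
    refine (Metric.infDist_le_dist_of_mem hmem).trans ?_
    rw [dist_smul₀, Real.norm_of_nonneg (by norm_num)]
    have := dist_add_add_le x y x' y'
    linarith
  have hgain : Metric.infDist ((1/2:ℝ) • (x + y)) (Bder X e (k+1)) + η ≤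
      (Metric.infDist x (Bder X e (k+1)) + Metric.infDist y (Bder X e (k+1)))/2 := by
    have h1 : η * 4^(k+1) ≤ Metric.infDist x (Bder X e (k+1)) + Metric.infDist y (Bder X e (k+1)) := by
      by_contra hcon
      push Not at hcon
      have a1 : 0 ≤ Metric.infDist x (Bder X e (k+1)) := Metric.infDist_nonneg
      have a2 : 0 ≤ Metric.infDist y (Bder X e (k+1)) := Metric.infDist_nonneg
      exact hk1 ⟨hk1n, by linarith, by linarith⟩
    have h2 : (1:ℝ) ≤ 4^k := one_le_pow₀ (by norm_num)
    rw [pow_succ] at h1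
    nlinarith
  rw [← Finset.sum_add_distrib, Finset.sum_div]
  have hmem' : k+1 ∈ Finset.range n := Finset.mem_range.2 hk1n
  rw [← Finset.add_sum_erase _ _ hmem', ← Finset.add_sum_erase _ (fun i => (Metric.infDist x (Bder X e i) + Metric.infDist y (Bder X e i))/2) hmem']
  have : ∑ i ∈ (Finset.range n).erase (k+1), Metric.infDist ((1/2:ℝ) • (x + y)) (Bder X e i) ≤
      ∑ i ∈ (Finset.range n).erase (k+1), (Metric.infDist x (Bder X e i) + Metric.infDist y (Bder X e i))/2 := by
    apply Finset.sum_le_sum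
    intro i hi
    have hi' := Finset.mem_range.1 (Finset.mem_of_mem_erase hi)
    exact mid_infDist (Bder_convex e i) (hne i hi') x y
  linarith

theorem infDist_neg_eq {s : Set X} (hs : ∀ x ∈ s, -x ∈ s) (x : X) :
    Metric.infDist (-x) s = Metric.infDist x s := by
  have key : ∀ z : X, s.Nonempty → Metric.infDist (-z) s ≤ Metric.infDist z s := by
    intro z hne
    apply (Metric.le_infDist hne).2
    intro y hy
    have := Metric.infDist_le_dist_of_mem (x := -z) (hs y hy)
    rwa [dist_neg_neg] at this
  rcases s.eq_empty_or_nonempty with rfl | hne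
  · simp
  · apply le_antisymm (key x hne)
    simpa using key (-x) hne

theorem renorming (H : ∀ ε > (0:ℝ), ∃ n, Bder X ε n = ∅) : HasEquivUnifConvexNorm X := by
  classical
  let e : ℕ → ℝ := fun j => 1/((j:ℝ)+1)
  have he : ∀ j, 0 < e j := fun j => by positivity
  have H' : ∀ j, ∃ n, Bder X (e j) n = ∅ ∧ ∀ k < n, (Bder X (e j) k).Nonempty := by
    intro j
    refine ⟨Nat.find (H _ (he j)), Nat.find_spec (H _ (he j)), fun k hk => ?_⟩
    exact Set.nonempty_iff_ne_empty.2 (Nat.find_min (H _ (he j)) hk)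
  choose n hemp hne using H'
  choose η hη hgain using fun j => gain_lemma (he j) (hne j) (hemp j)
  let h : ℕ → X → ℝ := fun j x => ∑ k ∈ Finset.range (n j), Metric.infDist x (Bder X (e j) k)
  have hh0 : ∀ j x, 0 ≤ h j x := fun j x => Finset.sum_nonneg (fun k _ => Metric.infDist_nonneg)
  have hhn : ∀ j x, h j x ≤ n j * ‖x‖ := by
    intro j x
    have : h j x ≤ ∑ k ∈ Finset.range (n j), ‖x‖ := by
      apply Finset.sum_le_sum
      intro k hk
      have := Metric.infDist_le_dist_of_mem (x := x) (Bder_zero_mem (e j) k (hne j k (Finset.mem_range.1 hk)))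
      simpa using this
    simpa using this
  have hhl : ∀ j x y, h j x ≤ h j y + n j * ‖x - y‖ := by
    intro j x y
    have : h j x ≤ ∑ k ∈ Finset.range (n j), (Metric.infDist y (Bder X (e j) k) + ‖x - y‖) := by
      apply Finset.sum_le_sum
      intro k hk
      rw [← dist_eq_norm]
      exact Metric.infDist_le_infDist_add_dist
    rw [Finset.sum_add_distrib] at this
    simpa using this
  have hhc : ∀ j x y (a b : ℝ), 0 ≤ a → 0 ≤ b → a + b = 1 → h j (a • x + b • y) ≤ a * h j x + b * h j y := by
    intro j x y a b ha hb hab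
    simp only [h]
    rw [Finset.mul_sum, Finset.mul_sum, ← Finset.sum_add_distrib]
    apply Finset.sum_le_sum
    intro k hk
    exact infDist_conv (Bder_convex _ _) (hne j k (Finset.mem_range.1 hk)) _ _ _ _ ha hb hab
  have hhneg : ∀ j x, h j (-x) = h j x := by
    intro j x
    exact Finset.sum_congr rfl (fun k _ => infDist_neg_eq (Bder_neg _ _) x)
  let c : ℕ → ℝ := fun j => (1/2)^j/2/((n j:ℝ)+1)
  have hc : ∀ j, 0 < c j := fun j => by positivity
  have hcn : ∀ j, c j * n j ≤ (1/2)^j/2 := by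
    intro j
    have : c j * n j ≤ c j * (n j + 1) := mul_le_mul_of_nonneg_left (by linarith) (hc j).le
    refine this.trans (le_of_eq ?_)
    simp only [c]; field_simp
  have hgs : Summable (fun j : ℕ => ((1:ℝ)/2)^j/2) := (summable_geometric_two).div_const 2
  have hgt : ∑' j : ℕ, ((1:ℝ)/2)^j/2 = 1 := by
    rw [tsum_div_const, tsum_geometric_two]; norm_num
  have hcx : ∀ j x, c j * h j x ≤ (1/2)^j/2 * ‖x‖ := by
    intro j x
    calc c j * h j x ≤ c j * (n j * ‖x‖) := mul_le_mul_of_nonneg_left (hhn j x) (hc j).le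
      _ = c j * n j * ‖x‖ := by ring
      _ ≤ _ := mul_le_mul_of_nonneg_right (hcn j) (norm_nonneg x)
  have hsum : ∀ x, Summable (fun j => c j * h j x) := fun x =>
    Summable.of_nonneg_of_le (fun j => mul_nonneg (hc j).le (hh0 j x)) (fun j => hcx j x) (hgs.mul_right ‖x‖)
  let F : X → ℝ := fun x => ‖x‖ + ∑' j, c j * h j x
  have hF1 : ∀ x, ‖x‖ ≤ F x := fun x => by
    have : 0 ≤ ∑' j, c j * h j x := tsum_nonneg (fun j => mul_nonneg (hc j).le (hh0 j x))
    simp only [F]; linarith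
  refine hasEquiv_of_F X F hF1 ?_ ?_ ?_ ?_ ?_
  · intro x
    have : ∑' j, c j * h j x ≤ ∑' j, (1/2)^j/2 * ‖x‖ :=
      (hsum x).tsum_le_tsum (fun j => hcx j x) (hgs.mul_right ‖x‖)
    rw [tsum_mul_right, hgt] at this
    simp only [F]; linarith
  · intro x; simp only [F, hhneg, norm_neg]
  · intro x y a b ha hb hab
    have h1 : ∑' j, c j * h j (a • x + b • y) ≤ ∑' j, (a * (c j * h j x) + b * (c j * h j y)) := by
      apply (hsum _).tsum_le_tsum _ (((hsum x).mul_left a).add ((hsum y).mul_left b))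
      intro j
      have := mul_le_mul_of_nonneg_left (hhc j x y a b ha hb hab) (hc j).le
      linarith
    rw [((hsum x).mul_left a).tsum_add ((hsum y).mul_left b), tsum_mul_left, tsum_mul_left] at h1
    have h2 : ‖a • x + b • y‖ ≤ a * ‖x‖ + b * ‖y‖ := by
      refine (norm_add_le _ _).trans ?_
      rw [norm_smul, norm_smul, Real.norm_of_nonneg ha, Real.norm_of_nonneg hb]
    simp only [F]; linarith
  · intro x y
    have h1 : ∑' j, c j * h j x ≤ ∑' j, (c j * h j y + (1/2)^j/2 * ‖x - y‖) := by
      apply (hsum _).tsum_le_tsum _ ((hsum y).add (hgs.mul_right ‖x-y‖))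
      intro j
      have a1 := mul_le_mul_of_nonneg_left (hhl j x y) (hc j).le
      have a2 := mul_le_mul_of_nonneg_right (hcn j) (norm_nonneg (x-y))
      linarith
    rw [(hsum y).tsum_add (hgs.mul_right ‖x-y‖), tsum_mul_right, hgt] at h1
    have h2 : ‖x‖ ≤ ‖y‖ + ‖x - y‖ := by
      have := norm_add_le y (x-y)
      rwa [add_sub_cancel] at this
    simp only [F]; linarith
  · intro ε hε
    obtain ⟨j, hj⟩ := exists_nat_one_div_lt (half_pos hε)
    refine ⟨c j * η j, mul_pos (hc j) (hη j), ?_⟩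
    intro x y hx hy hxy
    have hg := hgain j x y ((hF1 x).trans hx) ((hF1 y).trans hy) (by simp only [e]; linarith)
    have hmid : ∀ i, h i ((1/2:ℝ) • (x+y)) ≤ (h i x + h i y)/2 := by
      intro i
      have := hhc i x y (1/2) (1/2) (by norm_num) (by norm_num) (by norm_num)
      rw [smul_add]; linarith
    have h1 : ∑' i, (c i * h i ((1/2:ℝ) • (x+y)) + if i = j then c j * η j else 0) ≤
        ∑' i, ((1/2) * (c i * h i x) + (1/2) * (c i * h i y)) := by
      apply Summable.tsum_le_tsum _ _ (((hsum x).mul_left _).add ((hsum y).mul_left _))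
      · intro i
        by_cases hij : i = j
        · subst hij
          rw [if_pos rfl]
          have := mul_le_mul_of_nonneg_left hg (hc i).le
          simp only [h]
          linarith
        · rw [if_neg hij]
          have := mul_le_mul_of_nonneg_left (hmid i) (hc i).le
          linarith
      · exact (hsum _).add (hasSum_ite_eq j _).summable
    rw [(hsum _).tsum_add (hasSum_ite_eq j _).summable, tsum_ite_eq,
      ((hsum x).mul_left _).tsum_add ((hsum y).mul_left _), tsum_mul_left, tsum_mul_left] at h1
    have h2 : ‖(1/2:ℝ) • (x + y)‖ ≤ (‖x‖ + ‖y‖)/2 := by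
      rw [norm_smul, Real.norm_of_nonneg (by norm_num)]
      have := norm_add_le x y
      linarith
    simp only [F] at *
    linarith
end
section
variable {X : Type*} [NormedAddCommGroup X] [NormedSpace ℝ X]

theorem sq_jensen {S : Type*} [Fintype S] (W : S → ℝ) (hW : ∀ s, 0 ≤ W s) (hW1 : ∑ s, W s = 1) (r : S → ℝ) :
    (∑ s, W s * r s)^2 ≤ ∑ s, W s * (r s)^2 := by
  have e0 : ∀ c : ℝ, ∑ s, W s * (r s - c)^2 = ∑ s, W s * (r s)^2 - 2 * c * ∑ s, W s * r s + c^2 * ∑ s, W s := by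
    intro c
    rw [Finset.mul_sum, Finset.mul_sum, ← Finset.sum_sub_distrib, ← Finset.sum_add_distrib]
    apply Finset.sum_congr rfl
    intro s _; ring
  set μ := ∑ s, W s * r s with hμ
  have h : 0 ≤ ∑ s, W s * (r s - μ)^2 := Finset.sum_nonneg (fun s _ => mul_nonneg (hW s) (sq_nonneg _))
  rw [e0 μ, hW1] at h
  nlinarith

theorem norm_jensen {S : Type*} [Fintype S] (W : S → ℝ) (hW : ∀ s, 0 ≤ W s) (hW1 : ∑ s, W s = 1) (y : S → X) :
    ‖∑ s, W s • y s‖^2 ≤ ∑ s, W s * ‖y s‖^2 := by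
  refine le_trans ?_ (sq_jensen W hW hW1 (fun s => ‖y s‖))
  apply pow_le_pow_left₀ (norm_nonneg _)
  refine (norm_sum_le _ _).trans (le_of_eq ?_)
  apply Finset.sum_congr rfl
  intro s _
  rw [norm_smul, Real.norm_of_nonneg (hW s)]

/-- `x` is the starting point of an `L₂`-bounded martingale of length `n` with large increments. -/
def HasMart (θ : ℝ) (n : ℕ) (x : X) : Prop :=
  ∃ (Ω : Type) (_ : Fintype Ω) (w : Ω → ℝ) (f : ℕ → Ω → X), (∀ ω, 0 ≤ w ω) ∧ ∑ ω, w ω = 1 ∧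
    (∀ i ω, ‖f i ω‖ ≤ 1) ∧
    (∀ (v : X) (a : ℕ → ℝ), ‖v + (∑ i ∈ Finset.range (n+1), a i) • x‖^2 ≤
      ∑ ω, w ω * ‖v + ∑ i ∈ Finset.range (n+1), a i • f i ω‖^2) ∧
    (∀ (v : X) (a : ℕ → ℝ) (k : ℕ), 1 ≤ k → k ≤ n → θ^2 * (∑ i ∈ Finset.Ico k (n+1), a i)^2 ≤
      ∑ ω, w ω * ‖v + ∑ i ∈ Finset.range (n+1), a i • f i ω‖^2)

theorem hasMart_step {θ : ℝ} {n : ℕ} {x : X} {S : Type} [Fintype S] (W : S → ℝ) (hW : ∀ s, 0 ≤ W s)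
    (hW1 : ∑ s, W s = 1) (p : S → X) (hx : ‖x‖ ≤ 1) (hp : ∀ s, HasMart θ n (p s)) (hbar : ∑ s, W s • p s = x)
    (hvar : 4 * θ^2 ≤ ∑ s, W s * ‖p s - x‖^2) : HasMart θ (n+1) x := by
  choose Ω hΩ w f hw hw1 hf hA hB using hp
  refine ⟨Σ s, Ω s, inferInstance, fun q => W q.1 * w q.1 q.2,
    fun i q => match i with | 0 => x | i+1 => f q.1 i q.2, ?_, ?_, ?_, ?_, ?_⟩
  · intro q; exact mul_nonneg (hW _) (hw _ _)
  · rw [Fintype.sum_sigma]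
    simp only [← Finset.mul_sum, hw1, mul_one, hW1]
  · intro i q
    cases i with
    | zero => exact hx
    | succ i => exact hf _ _ _
  all_goals
    have key : ∀ (v : X) (a : ℕ → ℝ), (∑ q : (Σ s, Ω s), (W q.1 * w q.1 q.2) * ‖v + ∑ i ∈ Finset.range (n+1+1),
        a i • (match i with | 0 => x | i+1 => f q.1 i q.2)‖^2) =
        ∑ s, W s * ∑ ω, w s ω * ‖(v + a 0 • x) + ∑ i ∈ Finset.range (n+1), a (i+1) • f s i ω‖^2 := by
      intro v a
      rw [Fintype.sum_sigma]
      apply Finset.sum_congr rfl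
      intro s _
      rw [Finset.mul_sum]
      apply Finset.sum_congr rfl
      intro ω _
      rw [Finset.sum_range_succ', mul_assoc]
      simp only
      rw [add_comm (∑ i ∈ Finset.range (n+1), a (i+1) • f s i ω), ← add_assoc]
    have low : ∀ (v : X) (a : ℕ → ℝ), ∑ s, W s * ‖(v + a 0 • x) + (∑ i ∈ Finset.range (n+1), a (i+1)) • p s‖^2 ≤
        ∑ s, W s * ∑ ω, w s ω * ‖(v + a 0 • x) + ∑ i ∈ Finset.range (n+1), a (i+1) • f s i ω‖^2 := by
      intro v a
      apply Finset.sum_le_sum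
      intro s _
      exact mul_le_mul_of_nonneg_left (hA s (v + a 0 • x) (fun i => a (i+1))) (hW s)
    have jen : ∀ (v : X) (a : ℕ → ℝ), ‖v + (∑ i ∈ Finset.range (n+1+1), a i) • x‖^2 ≤
        ∑ s, W s * ‖(v + a 0 • x) + (∑ i ∈ Finset.range (n+1), a (i+1)) • p s‖^2 := by
      intro v a
      refine le_trans (le_of_eq ?_) (norm_jensen W hW hW1 _)
      congr 2
      simp only [smul_add, Finset.sum_add_distrib]
      simp only [← Finset.sum_smul, hW1, one_smul]
      rw [Finset.sum_range_succ', add_smul]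
      have : ∑ s, W s • (∑ i ∈ Finset.range (n+1), a (i+1)) • p s = (∑ i ∈ Finset.range (n+1), a (i+1)) • x := by
        rw [← hbar, Finset.smul_sum]
        apply Finset.sum_congr rfl
        intro s _
        rw [smul_comm]
      simp only [hW1, one_smul, this]
      abel
  · intro v a
    rw [key]
    exact (jen v a).trans (low v a)
  · intro v a k hk hkn
    rw [key]
    obtain ⟨k, rfl⟩ : ∃ k', k = k' + 1 := ⟨k-1, by omega⟩
    rw [← Finset.sum_Ico_add']
    rcases Nat.eq_zero_or_pos k with rfl | hk0
    · refine le_trans ?_ (low v a)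
      rw [← Finset.range_eq_Ico]
      have hj := jen v a
      rw [Finset.sum_range_succ', add_smul] at hj
      set T := ∑ i ∈ Finset.range (n+1), a (i+1) with hT
      set u := v + (T • x + a 0 • x) with hu
      have e1 : ∀ s, (v + a 0 • x) + T • p s = u + T • (p s - x) := by
        intro s; rw [hu, smul_sub]; abel
      simp only [e1] at hj ⊢
      set E := ∑ s, W s * ‖u + T • (p s - x)‖^2 with hE
      have h1 : ∑ s, W s * (T^2 * ‖p s - x‖^2) ≤ ∑ s, W s * (2 * ‖u + T • (p s - x)‖^2 + 2 * ‖u‖^2) := by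
        apply Finset.sum_le_sum
        intro s _
        apply mul_le_mul_of_nonneg_left _ (hW s)
        have h2 : ‖T • (p s - x)‖ ≤ ‖u + T • (p s - x)‖ + ‖u‖ := by
          have := norm_sub_le (u + T • (p s - x)) u
          rwa [add_sub_cancel_left] at this
        rw [norm_smul, Real.norm_eq_abs] at h2
        have h3 : T^2 * ‖p s - x‖^2 = (|T| * ‖p s - x‖)^2 := by rw [mul_pow, sq_abs]
        rw [h3]
        have h4 := pow_le_pow_left₀ (by positivity) h2 2
        nlinarith [sq_nonneg (‖u + T • (p s - x)‖ - ‖u‖)]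
      have h5 : ∑ s, W s * (2 * ‖u + T • (p s - x)‖^2 + 2 * ‖u‖^2) = 2 * E + 2 * ‖u‖^2 := by
        rw [hE, Finset.mul_sum]
        have : 2 * ‖u‖^2 = ∑ s, W s * (2 * ‖u‖^2) := by rw [← Finset.sum_mul, hW1, one_mul]
        rw [this, ← Finset.sum_add_distrib]
        apply Finset.sum_congr rfl
        intro s _; rw [← this]; ring
      have h6 : ∑ s, W s * (T^2 * ‖p s - x‖^2) = T^2 * ∑ s, W s * ‖p s - x‖^2 := by
        rw [Finset.mul_sum]
        apply Finset.sum_congr rfl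
        intro s _; ring
      rw [h5, h6] at h1
      have h7 := mul_le_mul_of_nonneg_left hvar (sq_nonneg T)
      linarith
    · calc θ^2 * (∑ i ∈ Finset.Ico k (n+1), a (i+1))^2
          = ∑ s, W s * (θ^2 * (∑ i ∈ Finset.Ico k (n+1), a (i+1))^2) := by
            rw [← Finset.sum_mul, hW1, one_mul]
        _ ≤ _ := by
            apply Finset.sum_le_sum
            intro s _
            exact mul_le_mul_of_nonneg_left (hB s (v + a 0 • x) (fun i => a (i+1)) k hk0 (by omega)) (hW s)

theorem hasMart_of_Bder {ε : ℝ} (hε : 0 < ε) (n : ℕ) : ∀ x ∈ Bder X ε n, HasMart (ε/4) n x := by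
  induction n with
  | zero =>
    intro x hx
    refine ⟨Unit, inferInstance, fun _ => 1, fun _ _ => x, by simp, by simp, ?_, ?_, ?_⟩
    · intro _ _; exact Bder_norm_le ε 0 x hx
    · intro v a; simp
    · intro v a k h1 h2; omega
  | succ n ih =>
    intro x hx
    have hx1 := Bder_norm_le ε _ x hx
    rw [Bder, mem_convexHull_iff_exists_fintype] at hx
    obtain ⟨ι, _, w, z, hw, hw1, hz, hsum⟩ := hx
    choose p hp q hq hpq hm using hz
    refine hasMart_step (S := ι × Bool) (fun s => w s.1 / 2) (fun s => by have := hw s.1; positivity) ?_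
      (fun s => if s.2 then p s.1 else q s.1) hx1 ?_ ?_ ?_
    · rw [Fintype.sum_prod_type]
      simp only [Fintype.sum_bool]
      rw [← hw1]
      apply Finset.sum_congr rfl
      intros; ring
    · rintro ⟨i, b⟩
      cases b
      · exact ih _ (hq i)
      · exact ih _ (hp i)
    · rw [Fintype.sum_prod_type, ← hsum]
      apply Finset.sum_congr rfl
      intro i _
      rw [hm i]
      simp [smul_smul, smul_add]
      congr 1
    · rw [Fintype.sum_prod_type]
      have : 4 * (ε/4)^2 = ∑ i, w i * (ε^2/4) := by rw [← Finset.sum_mul, hw1]; ring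
      rw [this]
      apply Finset.sum_le_sum
      intro i _
      simp only [Fintype.sum_bool, if_true, Bool.false_eq_true, if_false]
      have h1 : ε ≤ ‖p i - x‖ + ‖q i - x‖ := by
        refine (hpq i).trans ?_
        have := norm_sub_le (p i - x) (q i - x)
        rwa [sub_sub_sub_cancel_right] at this
      have h2 : ε^2 ≤ (‖p i - x‖ + ‖q i - x‖)^2 := pow_le_pow_left₀ hε.le h1 2
      have h3 : ε^2/4 ≤ (‖p i - x‖^2 + ‖q i - x‖^2)/2 := by
        nlinarith [sq_nonneg (‖p i - x‖ - ‖q i - x‖)]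
      have := mul_le_mul_of_nonneg_left h3 (hw i)
      linarith
end
section
open Filter Topology

/-- Limit of a bounded real sequence along a fixed nonprincipal ultrafilter. -/
noncomputable def UL (u : ℕ → ℝ) : ℝ := limUnder (hyperfilter ℕ : Filter ℕ) u

theorem UL_tendsto {u : ℕ → ℝ} {A B : ℝ} (h : ∀ n, A ≤ u n ∧ u n ≤ B) :
    Tendsto u (hyperfilter ℕ : Filter ℕ) (𝓝 (UL u)) ∧ A ≤ UL u ∧ UL u ≤ B := by
  have h1 : ∃ x ∈ Set.Icc A B, ((hyperfilter ℕ).map u : Filter ℝ) ≤ 𝓝 x := by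
    apply isCompact_Icc.ultrafilter_le_nhds ((hyperfilter ℕ).map u)
    rw [Filter.le_principal_iff]
    exact Filter.mem_map.2 (Filter.univ_mem' h)
  obtain ⟨x, hx, hle⟩ := h1
  have ht : Tendsto u (hyperfilter ℕ : Filter ℕ) (𝓝 x) := hle
  have : UL u = x := ht.limUnder_eq
  rw [this]
  exact ⟨ht, hx.1, hx.2⟩

theorem UL_const (r : ℝ) : UL (fun _ => r) = r := by
  have : Tendsto (fun _ : ℕ => r) (hyperfilter ℕ : Filter ℕ) (𝓝 r) := tendsto_const_nhds
  exact this.limUnder_eq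

/-- Iterated limit functional. -/
noncomputable def GLim (q : ℕ → (ℕ →₀ ℝ) → ℝ) : (ℕ →₀ ℝ) → List ℝ → ℝ
  | b, [] => UL (fun N => q N b)
  | b, a :: as => UL (fun n => GLim q (b + Finsupp.single n a) as)

noncomputable def l1 (b : ℕ →₀ ℝ) : ℝ := ∑ i ∈ b.support, |b i|

theorem l1_nonneg (b : ℕ →₀ ℝ) : 0 ≤ l1 b := Finset.sum_nonneg (fun _ _ => abs_nonneg _)

theorem l1_eq (b : ℕ →₀ ℝ) (s : Finset ℕ) (h : b.support ⊆ s) : l1 b = ∑ i ∈ s, |b i| := by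
  apply Finset.sum_subset h
  intro i _ hi
  simp only [Finsupp.mem_support_iff, not_not] at hi
  simp [hi]

theorem sum_le_l1 (b : ℕ →₀ ℝ) (s : Finset ℕ) : ∑ i ∈ s, |b i| ≤ l1 b := by
  rw [l1_eq b (b.support ∪ s) Finset.subset_union_left]
  exact Finset.sum_le_sum_of_subset_of_nonneg Finset.subset_union_right (fun _ _ _ => abs_nonneg _)

theorem l1_add (b : ℕ →₀ ℝ) (n : ℕ) (a : ℝ) : l1 (b + Finsupp.single n a) ≤ l1 b + |a| := by
  set s := (b.support ∪ {n}) ∪ (b + Finsupp.single n a).support with hs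
  rw [l1_eq b s (Finset.subset_union_left.trans Finset.subset_union_left),
    l1_eq _ s Finset.subset_union_right]
  have hn : n ∈ s := by simp [hs]
  have : |a| = ∑ i ∈ s, |Finsupp.single n a i| := by
    rw [Finset.sum_eq_single_of_mem n hn]
    · simp
    · intro i _ hi
      simp [Finsupp.single_apply, hi.symm]
  rw [this, ← Finset.sum_add_distrib]
  apply Finset.sum_le_sum
  intro i _
  exact abs_add_le _ _

section
variable {q : ℕ → (ℕ →₀ ℝ) → ℝ} {θ : ℝ}

def L1 (as : List ℝ) : ℝ := (as.map (fun x => |x|)).sum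

theorem L1_nonneg (as : List ℝ) : 0 ≤ L1 as := by
  apply List.sum_nonneg
  intro x hx
  simp only [List.mem_map] at hx
  obtain ⟨y, _, rfl⟩ := hx
  exact abs_nonneg y

theorem GL_bound
    (H1 : ∀ N b, 0 ≤ q N b ∧ q N b ≤ (∑ i ∈ Finset.range (N+1), |b i|)^2)
    (as : List ℝ) : ∀ b, 0 ≤ GLim q b as ∧ GLim q b as ≤ (l1 b + L1 as)^2 := by
  induction as with
  | nil =>
    intro b
    refine (UL_tendsto (fun N => ⟨(H1 N b).1, (H1 N b).2.trans ?_⟩)).2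
    apply pow_le_pow_left₀ (Finset.sum_nonneg (fun _ _ => abs_nonneg _))
    simpa [L1] using sum_le_l1 b _
  | cons a as ih =>
    intro b
    refine (UL_tendsto (fun n => ⟨(ih _).1, (ih _).2.trans ?_⟩)).2
    apply pow_le_pow_left₀ (add_nonneg (l1_nonneg _) (L1_nonneg _))
    have := l1_add b n a
    simp only [L1, List.map_cons, List.sum_cons] at *
    linarith

theorem GL_tendsto_nil
    (H1 : ∀ N b, 0 ≤ q N b ∧ q N b ≤ (∑ i ∈ Finset.range (N+1), |b i|)^2)
    (b : ℕ →₀ ℝ) : Tendsto (fun N => q N b) (hyperfilter ℕ : Filter ℕ) (𝓝 (GLim q b [])) := by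
  refine (UL_tendsto (A := 0) (B := (l1 b)^2) (fun N => ⟨(H1 N b).1, (H1 N b).2.trans ?_⟩)).1
  apply pow_le_pow_left₀ (Finset.sum_nonneg (fun _ _ => abs_nonneg _))
  exact sum_le_l1 b _

theorem GL_tendsto_cons
    (H1 : ∀ N b, 0 ≤ q N b ∧ q N b ≤ (∑ i ∈ Finset.range (N+1), |b i|)^2)
    (b : ℕ →₀ ℝ) (a : ℝ) (as : List ℝ) :
    Tendsto (fun n => GLim q (b + Finsupp.single n a) as) (hyperfilter ℕ : Filter ℕ) (𝓝 (GLim q b (a :: as))) := by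
  refine (UL_tendsto (A := 0) (B := (l1 b + |a| + L1 as)^2) (fun n => ⟨(GL_bound H1 as _).1, (GL_bound H1 as _).2.trans ?_⟩)).1
  apply pow_le_pow_left₀ (add_nonneg (l1_nonneg _) (L1_nonneg _))
  have := l1_add b n a
  linarith

theorem GL_filter (as : List ℝ) : ∀ b, GLim q b as = GLim q b (as.filter (fun x => decide (x ≠ 0))) := by
  induction as with
  | nil => intro b; rfl
  | cons a as ih =>
    intro b
    by_cases ha : a = 0
    · subst ha
      simp only [ne_eq, not_true_eq_false, decide_false, Bool.false_eq_true, not_false_eq_true, List.filter_cons_of_neg]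
      rw [← ih b, GLim]
      simp only [Finsupp.single_zero, add_zero]
      exact UL_const _
    · rw [List.filter_cons_of_pos (by simpa using ha), GLim, GLim]
      congr 1
      funext n
      exact ih _

noncomputable def ev {ι : Type} (i : ι) (P : List (ℕ × (ι → ℝ))) : ℕ →₀ ℝ :=
  (P.map (fun p => Finsupp.single p.1 (p.2 i))).sum

theorem GL_approx
    (H1 : ∀ N b, 0 ≤ q N b ∧ q N b ≤ (∑ i ∈ Finset.range (N+1), |b i|)^2)
    {ι : Type} [Fintype ι] (Z : List (ι → ℝ)) : ∀ (b : ι → (ℕ →₀ ℝ)) (M : ℕ) (η : ℝ), 0 < η →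
    ∃ (P : List (ℕ × (ι → ℝ))) (N : ℕ), P.map Prod.snd = Z ∧ (P.map Prod.fst).Pairwise (· < ·) ∧
      (∀ p ∈ P, M < p.1 ∧ p.1 ≤ N) ∧
      ∀ i, |q N (b i + ev i P) - GLim q (b i) (Z.map (fun z => z i))| < η := by
  induction Z with
  | nil =>
    intro b M η hη
    have h : ∀ᶠ N in (hyperfilter ℕ : Filter ℕ), ∀ i, |q N (b i) - GLim q (b i) []| < η := by
      rw [Filter.eventually_all]
      intro i
      exact (Metric.tendsto_nhds.1 (GL_tendsto_nil H1 (b i)) η hη)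
    obtain ⟨N, hN⟩ := h.exists
    refine ⟨[], N, rfl, by simp, by simp, ?_⟩
    intro i
    simpa [ev] using hN i
  | cons z Z ih =>
    intro b M η hη
    have h : ∀ᶠ N in (hyperfilter ℕ : Filter ℕ), ∀ i,
        |GLim q (b i + Finsupp.single N (z i)) (Z.map (fun z => z i)) - GLim q (b i) (z i :: Z.map (fun z => z i))| < η/2 := by
      rw [Filter.eventually_all]
      intro i
      exact (Metric.tendsto_nhds.1 (GL_tendsto_cons H1 (b i) (z i) _) (η/2) (by linarith))
    have h2 : ∀ᶠ N in (hyperfilter ℕ : Filter ℕ), M < N :=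
      Nat.hyperfilter_le_atTop (Filter.eventually_gt_atTop M)
    obtain ⟨m, hm, hmM⟩ := (h.and h2).exists
    obtain ⟨P, N, hP, hs, hI, hap⟩ := ih (fun i => b i + Finsupp.single m (z i)) m (η/2) (by linarith)
    -- need m ≤ N; enlarge via a trailing estimate
    by_cases hPn : P = []
    · subst hPn
      simp only [List.map_nil] at hP
      subst hP
      have h3 : ∀ᶠ N in (hyperfilter ℕ : Filter ℕ), ∀ i, |q N (b i + Finsupp.single m (z i)) - GLim q (b i + Finsupp.single m (z i)) []| < η/2 := by
        rw [Filter.eventually_all]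
        intro i
        exact (Metric.tendsto_nhds.1 (GL_tendsto_nil H1 _) (η/2) (by linarith))
      have h4 : ∀ᶠ N in (hyperfilter ℕ : Filter ℕ), m < N :=
        Nat.hyperfilter_le_atTop (Filter.eventually_gt_atTop m)
      obtain ⟨N, hN, hmN⟩ := (h3.and h4).exists
      refine ⟨[(m, z)], N, by simp, by simp, by simp; omega, ?_⟩
      intro i
      have e1 := hN i
      have e2 := hm i
      simp only [List.map_nil] at e2
      simp only [ev, List.map_cons, List.map_nil, List.sum_cons, List.sum_nil, add_zero]
      rw [abs_lt] at *
      constructor <;> linarith [e1.1, e1.2, e2.1, e2.2]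
    · obtain ⟨p, P', rfl⟩ := List.exists_cons_of_ne_nil hPn
      refine ⟨(m, z) :: p :: P', N, by rw [List.map_cons, hP], ?_, ?_, ?_⟩
      · rw [List.map_cons, List.pairwise_cons]
        refine ⟨?_, hs⟩
        intro a ha
        rw [List.mem_map] at ha
        obtain ⟨p', hp', rfl⟩ := ha
        exact (hI p' hp').1
      · intro p' hp'
        rw [List.mem_cons] at hp'
        rcases hp' with rfl | hp'
        · refine ⟨hmM, ?_⟩
          have := hI p (by simp)
          simp only
          omega
        · have := hI p' hp'
          omega
      · intro i
        have e1 := hap i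
        have e2 := hm i
        have : ev i ((m, z) :: p :: P') = Finsupp.single m (z i) + ev i (p :: P') := by
          simp [ev]
        rw [this, ← add_assoc, List.map_cons]
        rw [abs_lt] at *
        constructor <;> linarith [e1.1, e1.2, e2.1, e2.2]

theorem ev_sum {ι : Type} (i : ι) (P : List (ℕ × (ι → ℝ))) (s : Finset ℕ) :
    ∑ j ∈ s, ev i P j = (P.map (fun p => if p.1 ∈ s then p.2 i else 0)).sum := by
  induction P with
  | nil => simp [ev]
  | cons p P ih =>
    have : ev i (p :: P) = Finsupp.single p.1 (p.2 i) + ev i P := by simp [ev]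
    rw [this]
    simp only [Finsupp.add_apply, Finset.sum_add_distrib, ih, List.map_cons, List.sum_cons]
    congr 1
    simp [Finsupp.single_apply]

theorem GL_lower
    (H1 : ∀ N b, 0 ≤ q N b ∧ q N b ≤ (∑ i ∈ Finset.range (N+1), |b i|)^2)
    (H2 : ∀ N b k, 1 ≤ k → k ≤ N → θ^2 * (∑ i ∈ Finset.Ico k (N+1), b i)^2 ≤ q N b)
    (pre suf : List ℝ) : θ^2 * suf.sum^2 ≤ GLim q 0 (pre ++ suf) := by
  rcases suf with _ | ⟨s, suf⟩
  · simpa using (GL_bound H1 _ 0).1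
  apply le_of_forall_pos_le_add
  intro η hη
  obtain ⟨P, N, hP, hs, hI, hap⟩ := GL_approx H1 (ι := Unit) ((pre ++ (s :: suf)).map (fun x _ => x)) (fun _ => 0) 0 η hη
  rw [List.map_append, List.map_eq_append_iff] at hP
  obtain ⟨P1, P2, rfl, hP1, hP2⟩ := hP
  rw [List.map_cons, List.map_eq_cons_iff] at hP2
  obtain ⟨p, P2, rfl, hp, hP2⟩ := hP2
  have hpI := hI p (by simp)
  have h := H2 N (ev () (P1 ++ p :: P2)) p.1 hpI.1 hpI.2
  rw [ev_sum] at h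
  rw [List.map_append, List.pairwise_append] at hs
  obtain ⟨_, hs2, hs3⟩ := hs
  rw [List.map_cons, List.pairwise_cons] at hs2
  have h3 : ((P1 ++ p :: P2).map (fun p' => if p'.1 ∈ Finset.Ico p.1 (N+1) then p'.2 () else 0)).sum = (s :: suf).sum := by
    rw [List.map_append, List.sum_append]
    have e1 : (P1.map (fun p' => if p'.1 ∈ Finset.Ico p.1 (N+1) then p'.2 () else 0)).sum = 0 := by
      apply List.sum_eq_zero
      intro x hx
      rw [List.mem_map] at hx
      obtain ⟨p', hp', rfl⟩ := hx
      rw [if_neg]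
      rw [Finset.mem_Ico]
      have := hs3 p'.1 (List.mem_map_of_mem hp') p.1 (by simp)
      omega
    have e2 : (p :: P2).map (fun p' => if p'.1 ∈ Finset.Ico p.1 (N+1) then p'.2 () else 0) = (p :: P2).map (fun p' => p'.2 ()) := by
      apply List.map_congr_left
      intro p' hp'
      rw [if_pos]
      rw [Finset.mem_Ico]
      refine ⟨?_, ?_⟩
      · rw [List.mem_cons] at hp'
        rcases hp' with rfl | hp'
        · exact le_rfl
        · exact (hs2.1 _ (List.mem_map_of_mem hp')).le
      · have := hI p' (List.mem_append_right _ hp')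
        omega
    have e3 : (p :: P2).map (fun p' => p'.2 ()) = s :: suf := by
      have : ((p :: P2).map Prod.snd).map (fun z => z ()) = s :: suf := by
        rw [List.map_cons, hp, hP2]
        simp [Function.comp_def]
      rw [← this, List.map_map]
      rfl
    rw [e1, e2, e3, zero_add]
  rw [h3] at h
  have h4 := hap ()
  rw [List.map_map] at h4
  have h5 : ((fun z : Unit → ℝ => z ()) ∘ (fun (x : ℝ) (_ : Unit) => x)) = id := by funext x; rfl
  rw [h5, List.map_id, zero_add, abs_lt] at h4
  linarith [h4.2]

/-- The list has `m` nested suffixes with sums `c, -c, c, …`. -/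
def Alt : ℝ → ℕ → List ℝ → Prop
  | _, 0, _ => True
  | c, m+1, a => ∃ pre suf, a = pre ++ suf ∧ suf.sum = c ∧ Alt (-c) m suf

theorem Alt_prepend {c : ℝ} {m : ℕ} {a : List ℝ} (p : List ℝ) (h : Alt c m a) : Alt c m (p ++ a) := by
  cases m with
  | zero => trivial
  | succ m =>
    obtain ⟨pre, suf, rfl, h1, h2⟩ := h
    exact ⟨p ++ pre, suf, by simp, h1, h2⟩

def Seg : ℝ → List (List ℝ) → Prop
  | _, [] => True
  | c, s :: segs => (s :: segs).flatten.sum = c ∧ Seg (-c) segs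

theorem Alt_seg (m : ℕ) : ∀ (c : ℝ) (a : List ℝ), Alt c m a → ∃ s0 segs, a = s0 ++ segs.flatten ∧ segs.length = m ∧ Seg c segs := by
  induction m with
  | zero => intro c a _; exact ⟨a, [], by simp, rfl, trivial⟩
  | succ m ih =>
    rintro c a ⟨pre, suf, rfl, h1, h2⟩
    obtain ⟨s0, segs, rfl, h3, h4⟩ := ih _ _ h2
    exact ⟨pre, s0 :: segs, by simp, by simp [h3], by simpa using h1, h4⟩

def altList : ℝ → ℕ → List ℝ
  | _, 0 => []
  | c, m+1 => (c - (altList (-c) m).sum) :: altList (-c) m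

theorem altList_sum (c : ℝ) (m : ℕ) : (altList c (m+1)).sum = c := by
  simp [altList]

theorem altList_alt (m : ℕ) : ∀ c, Alt c m (altList c m) := by
  induction m with
  | zero => intro c; trivial
  | succ m ih =>
    intro c
    exact ⟨[], altList c (m+1), rfl, altList_sum c m, Alt_prepend [_] (ih (-c))⟩

theorem altList_L1 (m : ℕ) : ∀ c, L1 (altList c m) ≤ 2 * |c| * m := by
  induction m with
  | zero => intro c; simp [altList, L1]
  | succ m ih =>
    intro c
    have h := ih (-c)
    have e : L1 (altList c (m+1)) = |c - (altList (-c) m).sum| + L1 (altList (-c) m) := by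
      simp [altList, L1]
    have h2 : |c - (altList (-c) m).sum| ≤ 2 * |c| := by
      cases m with
      | zero => simp [altList]; linarith [abs_nonneg c]
      | succ m =>
        rw [altList_sum, sub_neg_eq_add, ← two_mul, abs_mul]; simp
    rw [e]
    rw [abs_neg] at h
    push_cast
    linarith

noncomputable def KK (q : ℕ → (ℕ →₀ ℝ) → ℝ) (m : ℕ) : ℝ :=
  sInf {r | ∃ c a, c ≠ 0 ∧ Alt c m a ∧ r = GLim q 0 a / c^2}

theorem KK_le
    (H1 : ∀ N b, 0 ≤ q N b ∧ q N b ≤ (∑ i ∈ Finset.range (N+1), |b i|)^2)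
    {c : ℝ} {m : ℕ} {a : List ℝ} (hc : c ≠ 0) (h : Alt c m a) : c^2 * KK q m ≤ GLim q 0 a := by
  have : KK q m ≤ GLim q 0 a / c^2 := by
    apply csInf_le
    · refine ⟨0, ?_⟩
      rintro r ⟨c, a, _, _, rfl⟩
      have := (GL_bound H1 a 0).1
      positivity
    · exact ⟨c, a, hc, h, rfl⟩
  rw [le_div_iff₀ (by positivity)] at this
  linarith

theorem KK_nonempty (m : ℕ) : {r | ∃ c a, c ≠ 0 ∧ Alt c m a ∧ r = GLim q 0 a / c^2}.Nonempty :=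
  ⟨_, 1, altList 1 m, one_ne_zero, altList_alt m 1, rfl⟩

theorem KK_upper
    (H1 : ∀ N b, 0 ≤ q N b ∧ q N b ≤ (∑ i ∈ Finset.range (N+1), |b i|)^2)
    (m : ℕ) : KK q m ≤ 4 * (m:ℝ)^2 := by
  have h := KK_le H1 one_ne_zero (altList_alt m 1)
  have h2 := (GL_bound H1 (altList 1 m) 0).2
  have h3 := altList_L1 m 1
  have h4 : l1 (0 : ℕ →₀ ℝ) = 0 := by simp [l1]
  rw [h4, zero_add] at h2
  have h5 := pow_le_pow_left₀ (L1_nonneg _) h3 2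
  simp only [abs_one] at h5
  nlinarith

theorem KK_lower
    (H1 : ∀ N b, 0 ≤ q N b ∧ q N b ≤ (∑ i ∈ Finset.range (N+1), |b i|)^2)
    (H2 : ∀ N b k, 1 ≤ k → k ≤ N → θ^2 * (∑ i ∈ Finset.Ico k (N+1), b i)^2 ≤ q N b)
    (m : ℕ) : θ^2 ≤ KK q (m+1) := by
  apply le_csInf (KK_nonempty _)
  rintro r ⟨c, a, hc, ⟨pre, suf, rfl, h1, _⟩, rfl⟩
  rw [le_div_iff₀ (by positivity), ← h1]
  exact GL_lower H1 H2 pre suf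

theorem KK_ratio
    (H1 : ∀ N b, 0 ≤ q N b ∧ q N b ≤ (∑ i ∈ Finset.range (N+1), |b i|)^2)
    (H2 : ∀ N b k, 1 ≤ k → k ≤ N → θ^2 * (∑ i ∈ Finset.Ico k (N+1), b i)^2 ≤ q N b)
    (hθ : 0 < θ) {τ : ℝ} (hτ : 0 < τ) (hτ1 : τ < 1) : ∃ m, (1 - τ) * KK q (m+2) ≤ KK q (m+1) := by
  by_contra hcon
  push Not at hcon
  have h1 : ∀ m, KK q 1 ≤ (1-τ)^m * KK q (m+1) := by
    intro m
    induction m with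
    | zero => simp
    | succ m ih =>
      refine ih.trans ?_
      rw [pow_succ, mul_assoc]
      exact mul_le_mul_of_nonneg_left (hcon m).le (pow_nonneg (by linarith) _)
  have h2 := tendsto_pow_const_mul_const_pow_of_abs_lt_one 2 (r := 1 - τ) (by rw [abs_lt]; constructor <;> linarith)
  have h3 : 0 < θ^2 * (1-τ) / 4 := by
    have : 0 < 1 - τ := by linarith
    positivity
  have h4 := ((tendsto_add_atTop_nat 1).eventually (h2.eventually (gt_mem_nhds h3))).exists
  obtain ⟨m, hm⟩ := h4
  have h5 := KK_lower H1 H2 0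
  have h6 := h1 m
  have h7 := KK_upper H1 (m+1)
  have h8 := mul_le_mul_of_nonneg_left h7 (pow_nonneg (by linarith : 0 ≤ 1 - τ) m)
  have h9 : (1-τ)^m * (4 * ((m+1 : ℕ) : ℝ)^2) * (1-τ) < θ^2 * (1-τ) := by
    have : (1-τ)^(m+1) = (1-τ)^m * (1-τ) := pow_succ _ _
    rw [this] at hm
    linarith
  have h10 := lt_of_mul_lt_mul_right h9 (by linarith)
  simp only [zero_add] at h5
  linarith

def slot (n : ℕ) (e : ℕ → ℝ) (s : List ℝ) : List ℝ := (List.range n).flatMap (fun j => s.map (fun r => e j * r))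

theorem slot_filter {n j : ℕ} (hj : j < n) (s : List ℝ) :
    (slot n (fun j' => if j' = j then 1 else 0) s).filter (fun x => decide (x ≠ 0)) = s.filter (fun x => decide (x ≠ 0)) := by
  unfold slot
  have h : ∀ m, ((List.range m).flatMap (fun j' => s.map (fun r => (if j' = j then (1:ℝ) else 0) * r))).filter (fun x => decide (x ≠ 0))
      = if j < m then s.filter (fun x => decide (x ≠ 0)) else [] := by
    intro m
    induction m with
    | zero => simp
    | succ m ih =>
      rw [List.range_succ, List.flatMap_append, List.filter_append, ih]
      simp only [List.flatMap_cons, List.flatMap_nil, List.append_nil]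
      rcases lt_trichotomy j m with h | h | h
      · have h' : j < m + 1 := by omega
        rw [if_pos h, if_pos h']
        have : ¬ (m = j) := by omega
        simp [this, List.filter_eq_nil_iff]
      · subst h
        simp
      · have h1 : ¬ j < m := by omega
        have h2 : ¬ j < m + 1 := by omega
        rw [if_neg h1, if_neg h2]
        have : ¬ (m = j) := by omega
        simp [this, List.filter_eq_nil_iff]
  rw [h n, if_pos hj]

theorem sum_flatMap_const (l : List ℕ) (e : ℕ → ℝ) (r : ℝ) (h : ∀ j ∈ l, e j = r) (s : List ℝ) :
    (l.flatMap (fun j => s.map (fun x => e j * x))).sum = r * l.length * s.sum := by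
  induction l with
  | nil => simp
  | cons j l ih =>
    rw [List.flatMap_cons, List.sum_append, ih (fun j hj => h j (List.mem_cons_of_mem _ hj)), List.sum_map_mul_left,
      h j (by simp)]
    simp only [List.map_id', List.length_cons]
    push_cast
    ring

theorem slot_split {n k : ℕ} (hk : k ≤ n) (s : List ℝ) : ∃ A B, slot n (fun j => if j < k then -1 else 1) s = A ++ B ∧
    A.sum = - k * s.sum ∧ B.sum = (n - k) * s.sum := by
  obtain ⟨d, rfl⟩ := Nat.exists_eq_add_of_le hk
  refine ⟨_, _, by rw [slot, List.range_add, List.flatMap_append], ?_, ?_⟩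
  · rw [sum_flatMap_const _ _ (-1)]
    · simp
    · intro j hj
      rw [List.mem_range] at hj
      simp [hj]
  · rw [sum_flatMap_const _ _ 1]
    · simp
    · intro j hj
      rw [List.mem_map] at hj
      obtain ⟨i, _, rfl⟩ := hj
      simp

theorem slot_sum {n k : ℕ} (hk : k ≤ n) (segs : List (List ℝ)) :
    (segs.flatMap (slot n (fun j => if j < k then -1 else 1))).sum = (n - 2 * k) * segs.flatten.sum := by
  induction segs with
  | nil => simp
  | cons s segs ih =>
    obtain ⟨A, B, h, hA, hB⟩ := slot_split hk s
    rw [List.flatMap_cons, List.sum_append, ih, h, List.sum_append, hA, hB, List.flatten_cons, List.sum_append]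
    ring

theorem slot_alt {n k : ℕ} (hk : k ≤ n) (m : ℕ) : ∀ (c : ℝ) (segs : List (List ℝ)), segs.length = m+1 → Seg c segs →
    Alt (n * c) m (segs.flatMap (slot n (fun j => if j < k then -1 else 1))) := by
  induction m with
  | zero => intros; trivial
  | succ m ih =>
    intro c segs hl hs
    obtain ⟨s, segs, rfl⟩ := List.exists_cons_of_length_eq_add_one hl
    simp only [List.length_cons] at hl
    have hl' : segs.length = m + 1 := by omega
    obtain ⟨s', segs', rfl⟩ := List.exists_cons_of_length_eq_add_one hl'
    obtain ⟨h1, h2⟩ := hs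
    have h3 := h2.1
    obtain ⟨A, B, h, hA, hB⟩ := slot_split hk s
    rw [List.flatten_cons, List.sum_append, h3] at h1
    refine ⟨A, B ++ (s' :: segs').flatMap (slot n (fun j => if j < k then -1 else 1)), ?_, ?_, ?_⟩
    · rw [List.flatMap_cons, h, List.append_assoc]
    · rw [List.sum_append, hB, slot_sum hk, h3]
      have : s.sum = 2 * c := by linarith
      rw [this]; ring
    · apply Alt_prepend
      have := ih (-c) _ hl' h2
      rwa [mul_neg] at this

theorem ev_lin {n : ℕ} {ι : Type} (i : ι) (J : Fin n → ι) (e : Fin n → ℝ) (P : List (ℕ × (ι → ℝ)))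
    (h : ∀ p ∈ P, p.2 i = ∑ j, e j * p.2 (J j)) : ev i P = ∑ j, e j • ev (J j) P := by
  induction P with
  | nil => simp [ev]
  | cons p P ih =>
    have e1 : ∀ i, ev i (p :: P) = Finsupp.single p.1 (p.2 i) + ev i P := by intro i; simp [ev]
    simp only [e1, smul_add, Finset.sum_add_distrib]
    rw [ih (fun p hp => h p (List.mem_cons_of_mem _ hp)), h p (by simp)]
    congr 1
    simp only [Finsupp.smul_single, smul_eq_mul]
    rw [← Finsupp.single_finsetSum]

theorem spreading
    (H1 : ∀ N b, 0 ≤ q N b ∧ q N b ≤ (∑ i ∈ Finset.range (N+1), |b i|)^2)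
    (H2 : ∀ N b k, 1 ≤ k → k ≤ N → θ^2 * (∑ i ∈ Finset.Ico k (N+1), b i)^2 ≤ q N b)
    (hθ : 0 < θ) {n : ℕ} (hn : 1 ≤ n) {τ : ℝ} (hτ : 0 < τ) (hτ1 : τ < 1) :
    ∃ (N : ℕ) (R : ℝ) (x : Fin n → (ℕ →₀ ℝ)), 0 < R ∧ (∀ j, q N (x j) ≤ R * (1+τ)) ∧
      ∀ k ≤ n, (n:ℝ)^2 * R * (1-τ)^2 ≤ q N (∑ j : Fin n, (if (j:ℕ) < k then (-1:ℝ) else 1) • x j) := by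
  obtain ⟨m, hm⟩ := KK_ratio H1 H2 hθ hτ hτ1
  have hKpos : 0 < KK q (m+2) := lt_of_lt_of_le (by positivity) (KK_lower H1 H2 (m+1))
  have hlt : KK q (m+2) < KK q (m+2) * (1+τ) := by nlinarith
  obtain ⟨r, ⟨c, a, hc, ha, rfl⟩, hr⟩ := exists_lt_of_csInf_lt (KK_nonempty (m+2)) hlt
  have hc2 : 0 < c^2 := by positivity
  rw [div_lt_iff₀ hc2] at hr
  obtain ⟨s0, segs, hae, hl, hseg⟩ := Alt_seg _ _ _ ha
  set R := c^2 * KK q (m+2) with hR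
  have hRpos : 0 < R := by positivity
  have hnpos : (0:ℝ) < n := by exact_mod_cast hn
  let E : Fin n ⊕ Fin (n+1) → ℕ → ℝ := fun i => Sum.elim (fun (j : Fin n) (j' : ℕ) => if j' = j then (1:ℝ) else 0)
    (fun (k : Fin (n+1)) (j' : ℕ) => if j' < k then (-1:ℝ) else 1) i
  let Z : List (Fin n ⊕ Fin (n+1) → ℝ) := (s0 :: segs).flatMap (fun s => (List.range n).flatMap (fun j' => s.map (fun r i => E i j' * r)))
  have hZ : ∀ i, Z.map (fun z => z i) = (s0 :: segs).flatMap (slot n (E i)) := by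
    intro i
    simp only [Z, List.map_flatMap, List.map_map, Function.comp_def]
    rfl
  have hη : 0 < min (R * (1+τ) - GLim q 0 a) ((n:ℝ)^2 * R * (1-τ) * τ) := by
    rw [lt_min_iff]
    constructor
    · rw [hR]; linarith
    · have : 0 < 1 - τ := by linarith
      positivity
  obtain ⟨P, N, hP, _, _, hap⟩ := GL_approx H1 Z (fun _ => 0) 0 _ hη
  refine ⟨N, R, fun j => ev (Sum.inl j) P, hRpos, ?_, ?_⟩
  · intro j
    have h := hap (Sum.inl j)
    rw [zero_add, hZ, abs_lt] at h
    have h2 : GLim q 0 ((s0 :: segs).flatMap (slot n (E (Sum.inl j)))) = GLim q 0 a := by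
      rw [GL_filter _ 0, GL_filter a 0, hae]
      congr 1
      have h3 : ∀ l : List (List ℝ), (l.flatMap (slot n (E (Sum.inl j)))).filter (fun x => decide (x ≠ 0)) = l.flatten.filter (fun x => decide (x ≠ 0)) := by
        intro l
        induction l with
        | nil => rfl
        | cons s l ih =>
          rw [List.flatMap_cons, List.filter_append, ih, List.flatten_cons, List.filter_append]
          congr 1
          exact slot_filter j.2 s
      exact h3 (s0 :: segs)
    rw [h2] at h
    have := h.2
    have := min_le_left (R * (1+τ) - GLim q 0 a) ((n:ℝ)^2 * R * (1-τ) * τ)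
    linarith
  · intro k hk
    let i : Fin n ⊕ Fin (n+1) := Sum.inr ⟨k, by omega⟩
    have hlin : ev i P = ∑ j : Fin n, (if (j:ℕ) < k then (-1:ℝ) else 1) • ev (Sum.inl j) P := by
      apply ev_lin i (fun j => Sum.inl j) (fun j : Fin n => if (j:ℕ) < k then (-1:ℝ) else 1) P
      intro p hp
      have hp2 : p.2 ∈ Z := by rw [← hP]; exact List.mem_map_of_mem hp
      simp only [Z, List.mem_flatMap, List.mem_map, List.mem_range] at hp2
      obtain ⟨s, _, j', hj', r, _, he⟩ := hp2
      rw [← he]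
      simp only [E, i, Sum.elim_inl, Sum.elim_inr]
      rw [Finset.sum_eq_single (⟨j', hj'⟩ : Fin n)]
      · simp
      · intro b _ hb
        have : j' ≠ (b:ℕ) := by
          intro h; apply hb; ext; simp [h]
        simp [this]
      · simp
    rw [← hlin]
    have h := hap i
    rw [zero_add, hZ, abs_lt] at h
    have h2 : Alt (n * c) (m+1) ((s0 :: segs).flatMap (slot n (E i))) := by
      rw [List.flatMap_cons]
      apply Alt_prepend
      exact slot_alt hk (m+1) c segs hl hseg
    have h3 := KK_le H1 (mul_ne_zero hnpos.ne' hc) h2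
    have h4 : (n:ℝ)^2 * R * (1-τ) ≤ (n * c)^2 * KK q (m+1) := by
      have := mul_le_mul_of_nonneg_left hm (by positivity : 0 ≤ ((n:ℝ) * c)^2)
      rw [hR]; linarith
    have h5 := min_le_right (R * (1+τ) - GLim q 0 a) ((n:ℝ)^2 * R * (1-τ) * τ)
    nlinarith [h.1]
end
end
section
variable {X : Type*} [NormedAddCommGroup X] [NormedSpace ℝ X]

/-- Signed sum: minus signs on the first `k` vectors. -/
noncomputable def Sg {n : ℕ} (x : Fin n → X) (k : ℕ) : X := ∑ j : Fin n, (if (j:ℕ) < k then (-1:ℝ) else 1) • x j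

theorem Sg_norm_le {n : ℕ} (x : Fin n → X) (k : ℕ) : ‖Sg x k‖ ≤ ∑ j, ‖x j‖ := by
  refine (norm_sum_le _ _).trans (Finset.sum_le_sum ?_)
  intro j _
  rw [norm_smul]
  split_ifs <;> simp

theorem Sg_sq_le {n : ℕ} (x : Fin n → X) (k : ℕ) : ‖Sg x k‖^2 ≤ n * ∑ j, ‖x j‖^2 := by
  have h1 := pow_le_pow_left₀ (norm_nonneg _) (Sg_norm_le x k) 2
  have h2 := sq_sum_le_card_mul_sum_sq (s := (Finset.univ : Finset (Fin n))) (f := fun j => ‖x j‖)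
  simp only [Finset.card_univ, Fintype.card_fin] at h2
  exact h1.trans h2

theorem pair_var {n : ℕ} (r : Fin n → ℝ) (a b : Fin n) : (r a - r b)^2 ≤ n * ∑ j, r j^2 - (∑ j, r j)^2 := by
  have e : ∑ i, ∑ j, (r i - r j)^2 = 2 * (n * ∑ j, r j^2 - (∑ j, r j)^2) := by
    have e1 : ∀ i j, (r i - r j)^2 = r i^2 + r j^2 - 2 * (r i * r j) := by intros; ring
    simp only [e1, Finset.sum_add_distrib, Finset.sum_sub_distrib, Finset.sum_const, Finset.card_univ, Fintype.card_fin,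
      ← Finset.mul_sum, ← Finset.sum_mul, nsmul_eq_mul]
    ring
  by_cases hab : a = b
  · subst hab
    have : 0 ≤ ∑ i, ∑ j, (r i - r j)^2 := Finset.sum_nonneg (fun i _ => Finset.sum_nonneg (fun j _ => sq_nonneg _))
    rw [sub_self]
    linarith
  · have h1 : ∀ i j, (r i - r j)^2 ≤ ∑ j, (r i - r j)^2 := fun i j =>
      Finset.single_le_sum (f := fun j => (r i - r j)^2) (fun _ _ => sq_nonneg _) (Finset.mem_univ j)
    have h2 : ∑ i ∈ {a, b}, ∑ j, (r i - r j)^2 ≤ ∑ i, ∑ j, (r i - r j)^2 :=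
      Finset.sum_le_sum_of_subset_of_nonneg (Finset.subset_univ _) (fun i _ _ => Finset.sum_nonneg (fun j _ => sq_nonneg _))
    rw [Finset.sum_pair hab] at h2
    have h3 := h1 a b
    have h4 := h1 b a
    nlinarith

theorem det_step {n : ℕ} (x : Fin n → X) {s C : ℝ} (hs : 0 < s) (hs1 : s ≤ 1/2) (hC : C * n = s^2)
    (hA : 0 < ∑ j, ‖x j‖^2) (hS : ∀ k ≤ n, (n - C) * ∑ j, ‖x j‖^2 ≤ ‖Sg x k‖^2) :
    ∃ y : Fin n → X, (∀ j, ‖y j‖ ≤ 1) ∧ ∀ k ≤ n, n - 2 * n * s ≤ ‖Sg y k‖ := by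
  have hn : 0 < n := by
    rcases Nat.eq_zero_or_pos n with h | h
    · subst h; simp at hA
    · exact h
  haveI : Nonempty (Fin n) := ⟨⟨0, hn⟩⟩
  obtain ⟨a, ha⟩ := Finite.exists_max (fun j => ‖x j‖)
  set M := ‖x a‖ with hM
  set A := ∑ j, ‖x j‖^2 with hAd
  have hn1 : (1:ℝ) ≤ n := by exact_mod_cast hn
  have hAM : A ≤ n * M^2 := by
    have : A ≤ ∑ j : Fin n, M^2 := Finset.sum_le_sum (fun j _ => pow_le_pow_left₀ (norm_nonneg _) (ha j) 2)
    simpa using this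
  have hMpos : 0 < M := by
    rcases (norm_nonneg (x a)).lt_or_eq with h | h
    · exact h
    · rw [hM, ← h] at hAM; simp at hAM; linarith
  have hCpos : 0 < C := by
    by_contra h
    push Not at h
    nlinarith [mul_nonneg (neg_nonneg.2 h) (by linarith : (0:ℝ) ≤ n), pow_pos hs 2]
  have h0 := hS 0 (Nat.zero_le _)
  have h1 := pow_le_pow_left₀ (norm_nonneg _) (Sg_norm_le x 0) 2
  have hb : ∀ b, (1 - s) * M ≤ ‖x b‖ := by
    intro b
    have h2 := pair_var (fun j => ‖x j‖) a b
    have h3 : (M - ‖x b‖)^2 ≤ (s * M)^2 := by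
      calc (M - ‖x b‖)^2 ≤ C * A := by rw [← hAd] at h2; simp only [← hM] at h2; linarith
        _ ≤ C * (n * M^2) := mul_le_mul_of_nonneg_left hAM hCpos.le
        _ = (s * M)^2 := by rw [← mul_assoc, hC]; ring
    have h4 := abs_le.1 (abs_le_of_sq_le_sq h3 (by positivity))
    linarith [h4.2]
  have hA2 : n * ((1-s)*M)^2 ≤ A := by
    have : ∑ j : Fin n, ((1-s)*M)^2 ≤ A := Finset.sum_le_sum (fun j _ => pow_le_pow_left₀ (mul_nonneg (by linarith) hMpos.le) (hb j) 2)
    simpa using this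
  have hCs : C ≤ s^2 := by nlinarith
  refine ⟨fun j => M⁻¹ • x j, ?_, ?_⟩
  · intro j
    rw [norm_smul, norm_inv, Real.norm_of_nonneg hMpos.le, inv_mul_le_iff₀ hMpos, mul_one]
    exact ha j
  · intro k hk
    have e : Sg (fun j => M⁻¹ • x j) k = M⁻¹ • Sg x k := by
      unfold Sg
      rw [Finset.smul_sum]
      apply Finset.sum_congr rfl
      intro j _
      rw [smul_comm]
    rw [e, norm_smul, norm_inv, Real.norm_of_nonneg hMpos.le, le_inv_mul_iff₀ hMpos]
    have hk2 := hS k hk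
    have h5 : (n * (1-s)^2 * M)^2 ≤ ‖Sg x k‖^2 := by
      calc (n * (1-s)^2 * M)^2 = (n * (1-s)^2) * (n * ((1-s)*M)^2) := by ring
        _ ≤ (n - C) * (n * ((1-s)*M)^2) := by
            apply mul_le_mul_of_nonneg_right _ (by positivity)
            have h7 : s ≤ n * (2 - s) := by nlinarith
            have h8 := mul_le_mul_of_nonneg_left h7 hs.le
            nlinarith
        _ ≤ (n - C) * A := by
            apply mul_le_mul_of_nonneg_left hA2
            nlinarith
        _ ≤ _ := hk2
    have h6 := abs_le.1 (abs_le_of_sq_le_sq h5 (norm_nonneg _))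
    refine le_trans ?_ h6.2
    nlinarith [mul_pos (mul_pos (by linarith : (0:ℝ) < n) hMpos) (pow_pos hs 2)]

theorem avg_step {n : ℕ} (hn : 1 ≤ n) {Ω : Type} [Fintype Ω] (w : Ω → ℝ) (hw : ∀ ω, 0 ≤ w ω)
    (x : Ω → Fin n → X) {R τ : ℝ} (hR : 0 < R) (hτ : 0 < τ) (hτ2 : τ ≤ 1/2)
    (h1 : ∀ j, ∑ ω, w ω * ‖x ω j‖^2 ≤ R * (1+τ))
    (h2 : ∀ k ≤ n, (n:ℝ)^2 * R * (1-τ)^2 ≤ ∑ ω, w ω * ‖Sg (x ω) k‖^2) :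
    ∃ ω, 0 < ∑ j, ‖x ω j‖^2 ∧ ∀ k ≤ n, (n - 13 * τ * (n+1) * n) * ∑ j, ‖x ω j‖^2 ≤ ‖Sg (x ω) k‖^2 := by
  have hn1 : (1:ℝ) ≤ n := by exact_mod_cast hn
  set A : Ω → ℝ := fun ω => ∑ j, ‖x ω j‖^2 with hA
  set C := 13 * τ * (n+1) * n with hC
  have hEA1 : ∑ ω, w ω * A ω ≤ n * (R * (1+τ)) := by
    simp only [hA, Finset.mul_sum]
    rw [Finset.sum_comm]
    refine (Finset.sum_le_sum (fun j _ => h1 j)).trans ?_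
    simp
  have hEA2 : n * R / 4 ≤ ∑ ω, w ω * A ω := by
    have h := h2 0 (Nat.zero_le _)
    have h3 : ∑ ω, w ω * ‖Sg (x ω) 0‖^2 ≤ n * ∑ ω, w ω * A ω := by
      rw [Finset.mul_sum]
      apply Finset.sum_le_sum
      intro ω _
      have := mul_le_mul_of_nonneg_left (Sg_sq_le (x ω) 0) (hw ω)
      simp only [hA]; linarith
    have h4 : (1:ℝ)/4 ≤ (1-τ)^2 := by nlinarith
    have h5 : (n:ℝ) * (n * R / 4) ≤ n * ∑ ω, w ω * A ω := by
      refine le_trans ?_ (h.trans h3)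
      have := mul_le_mul_of_nonneg_left h4 (by positivity : 0 ≤ (n:ℝ)^2 * R)
      linarith
    exact le_of_mul_le_mul_left h5 (by linarith)
  have hEF : ∑ ω, w ω * (∑ k ∈ Finset.range (n+1), (n * A ω - ‖Sg (x ω) k‖^2)) ≤ 3 * τ * (n+1) * n^2 * R := by
    have e : ∑ ω, w ω * (∑ k ∈ Finset.range (n+1), (n * A ω - ‖Sg (x ω) k‖^2)) =
        ∑ k ∈ Finset.range (n+1), (n * ∑ ω, w ω * A ω - ∑ ω, w ω * ‖Sg (x ω) k‖^2) := by
      simp only [Finset.mul_sum]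
      rw [Finset.sum_comm]
      apply Finset.sum_congr rfl
      intro k _
      rw [← Finset.sum_sub_distrib]
      apply Finset.sum_congr rfl
      intro ω _
      ring
    rw [e]
    have h3 : ∀ k ∈ Finset.range (n+1), (n * ∑ ω, w ω * A ω - ∑ ω, w ω * ‖Sg (x ω) k‖^2) ≤ 3 * τ * n^2 * R := by
      intro k hk
      rw [Finset.mem_range] at hk
      have h4 := h2 k (by omega)
      have h5 := mul_le_mul_of_nonneg_left hEA1 (by linarith : (0:ℝ) ≤ n)
      have : (n:ℝ) * (n * (R * (1+τ))) - n^2 * R * (1-τ)^2 ≤ 3 * τ * n^2 * R := by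
        have : 0 ≤ τ^2 * (n^2 * R) := by positivity
        nlinarith
      linarith
    refine (Finset.sum_le_sum h3).trans ?_
    simp
    apply le_of_eq; ring
  have hex : ∃ ω, (∑ k ∈ Finset.range (n+1), (n * A ω - ‖Sg (x ω) k‖^2)) < C * A ω := by
    by_contra hcon
    push Not at hcon
    have h3 : ∑ ω, w ω * (C * A ω) ≤ ∑ ω, w ω * (∑ k ∈ Finset.range (n+1), (n * A ω - ‖Sg (x ω) k‖^2)) :=
      Finset.sum_le_sum (fun ω _ => mul_le_mul_of_nonneg_left (hcon ω) (hw ω))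
    have e : ∑ ω, w ω * (C * A ω) = C * ∑ ω, w ω * A ω := by
      rw [Finset.mul_sum]; apply Finset.sum_congr rfl; intro ω _; ring
    rw [e] at h3
    have hCn : 0 ≤ C := by positivity
    have h4 := mul_le_mul_of_nonneg_left hEA2 hCn
    have h5 : 0 < τ * (n+1) * n^2 * R := by positivity
    rw [hC] at h4 h3
    nlinarith
  obtain ⟨ω, hω⟩ := hex
  have hnn : ∀ k ∈ Finset.range (n+1), 0 ≤ n * A ω - ‖Sg (x ω) k‖^2 := by
    intro k _
    have := Sg_sq_le (x ω) k
    simp only [hA]; linarith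
  refine ⟨ω, ?_, ?_⟩
  · have h3 := lt_of_le_of_lt (Finset.sum_nonneg hnn) hω
    have hCn : 0 < C := by positivity
    exact pos_of_mul_pos_right h3 hCn.le
  · intro k hk
    have h3 := Finset.single_le_sum hnn (Finset.mem_range.2 (by omega : k < n+1))
    change (n - C) * A ω ≤ _
    linarith

theorem signs_exist {ε : ℝ} (hε : 0 < ε) (hB : ∀ n, (Bder X ε n).Nonempty) {n : ℕ} (hn : 1 ≤ n) {δ : ℝ} (hδ : 0 < δ) :
    ∃ x : Fin n → X, (∀ j, ‖x j‖ ≤ 1) ∧ ∀ k ≤ n, n - δ ≤ ‖Sg x k‖ := by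
  have hM : ∀ N, ∃ x : X, HasMart (ε/4) N x := fun N => by
    obtain ⟨x, hx⟩ := hB N
    exact ⟨x, hasMart_of_Bder hε N x hx⟩
  choose x0 Ω hΩ w f hw hw1 hf _ hlow using hM
  have hn1 : (1:ℝ) ≤ n := by exact_mod_cast hn
  let V : (N : ℕ) → Ω N → (ℕ →₀ ℝ) → X := fun N ω b => ∑ i ∈ Finset.range (N+1), b i • f N i ω
  let q : ℕ → (ℕ →₀ ℝ) → ℝ := fun N b => ∑ ω, w N ω * ‖V N ω b‖^2
  have H1 : ∀ N b, 0 ≤ q N b ∧ q N b ≤ (∑ i ∈ Finset.range (N+1), |b i|)^2 := by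
    intro N b
    refine ⟨Finset.sum_nonneg (fun ω _ => mul_nonneg (hw N ω) (sq_nonneg _)), ?_⟩
    have h : ∀ ω, ‖V N ω b‖ ≤ ∑ i ∈ Finset.range (N+1), |b i| := by
      intro ω
      refine (norm_sum_le _ _).trans (Finset.sum_le_sum ?_)
      intro i _
      rw [norm_smul, Real.norm_eq_abs]
      exact mul_le_of_le_one_right (abs_nonneg _) (hf N i ω)
    calc q N b ≤ ∑ ω, w N ω * (∑ i ∈ Finset.range (N+1), |b i|)^2 :=
          Finset.sum_le_sum (fun ω _ => mul_le_mul_of_nonneg_left (pow_le_pow_left₀ (norm_nonneg _) (h ω) 2) (hw N ω))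
      _ = _ := by rw [← Finset.sum_mul, hw1, one_mul]
  have H2 : ∀ N b k, 1 ≤ k → k ≤ N → (ε/4)^2 * (∑ i ∈ Finset.Ico k (N+1), b i)^2 ≤ q N b := by
    intro N b k h1 h2
    have := hlow N 0 b k h1 h2
    simpa only [zero_add] using this
  set s := min (δ/(2*n)) (1/2) with hs
  have hspos : 0 < s := by
    rw [hs, lt_min_iff]; constructor <;> positivity
  have hs2 : s ≤ 1/2 := min_le_right _ _
  have hsδ : 2 * n * s ≤ δ := by
    have : s ≤ δ/(2*n) := min_le_left _ _
    rw [le_div_iff₀ (by positivity)] at this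
    linarith
  set τ := s^2 / (13 * (n+1) * n^2) with hτ
  have hτpos : 0 < τ := by positivity
  have hτ2 : τ ≤ 1/2 := by
    rw [hτ, div_le_iff₀ (by positivity)]
    nlinarith [mul_nonneg (by linarith : (0:ℝ) ≤ n) (sq_nonneg (n:ℝ))]
  obtain ⟨N, R, b, hR, hb1, hb2⟩ := spreading H1 H2 (by positivity : 0 < ε/4) hn hτpos (by linarith)
  have hlin : ∀ ω k, V N ω (∑ j : Fin n, (if (j:ℕ) < k then (-1:ℝ) else 1) • b j) = Sg (fun j => V N ω (b j)) k := by
    intro ω k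
    simp only [V, Sg, Finset.smul_sum]
    rw [Finset.sum_comm]
    apply Finset.sum_congr rfl
    intro i _
    rw [Finsupp.finsetSum_apply, Finset.sum_smul]
    apply Finset.sum_congr rfl
    intro j _
    rw [Finsupp.smul_apply, smul_eq_mul, mul_smul]
  obtain ⟨ω, hω1, hω2⟩ := avg_step hn (w N) (hw N) (fun ω j => V N ω (b j)) hR hτpos hτ2 hb1 (by
    intro k hk
    have := hb2 k hk
    simp only [q, hlin] at this
    exact this)
  obtain ⟨y, hy1, hy2⟩ := det_step (fun j => V N ω (b j)) hspos hs2 (C := 13 * τ * (n+1) * n) (by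
    rw [hτ]; field_simp) hω1 hω2
  exact ⟨y, hy1, fun k hk => le_trans (by linarith) (hy2 k hk)⟩
end
section
variable {X : Type*} [NormedAddCommGroup X] [NormedSpace ℝ X]

/-- Depth-first index of a vertex of the binary tree. -/
def tidx : ℕ → List Bool → ℕ
  | 0, _ => 0
  | _+1, [] => 0
  | h+1, b :: w => (b.toNat + 1) * 3^h + tidx h w

theorem tidx_nil (h : ℕ) : tidx h [] = 0 := by cases h <;> rfl

theorem tidx_lt (h : ℕ) : ∀ w, tidx h w < 3^h := by
  induction h with
  | zero => intro w; simp [tidx]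
  | succ h ih =>
    intro w
    cases w with
    | nil => simp [tidx]
    | cons b w =>
      have := ih w
      rw [tidx, pow_succ]
      cases b <;> simp <;> omega

theorem tidx_add_le (h : ℕ) : ∀ p : List Bool, p.length ≤ h → tidx h p + 3^(h - p.length) ≤ 3^h := by
  induction h with
  | zero => intro p hp; simp [tidx]
  | succ h ih =>
    intro p hp
    cases p with
    | nil => simp [tidx]
    | cons b p =>
      simp only [List.length_cons] at hp ⊢
      have := ih p (by omega)
      rw [tidx, pow_succ, Nat.add_sub_add_right]
      cases b <;> simp <;> omega

theorem tidx_prefix (h : ℕ) : ∀ p w : List Bool, p.length ≤ h → w.length ≤ h →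
    (p <+: w ↔ tidx h p ≤ tidx h w ∧ tidx h w < tidx h p + 3^(h - p.length)) := by
  induction h with
  | zero =>
    intro p w hp hw
    have : p = [] := List.length_eq_zero_iff.1 (by omega)
    subst this
    simp [tidx]
  | succ h ih =>
    intro p w hp hw
    cases p with
    | nil => simp [tidx, tidx_lt]
    | cons b p =>
      simp only [List.length_cons] at hp ⊢
      have h3 : 0 < 3^h := by positivity
      have h1 := tidx_add_le h p (by omega)
      rw [Nat.add_sub_add_right]
      cases w with
      | nil => simp [tidx]
      | cons c w =>
        simp only [List.length_cons] at hw
        have h2 := tidx_lt h w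
        have h4 := ih p w (by omega) (by omega)
        rw [List.cons_prefix_cons, tidx, tidx, h4]
        cases b <;> cases c <;> simp <;> omega

theorem sgn_functional {n : ℕ} {x : Fin n → X} (hx : ∀ j, ‖x j‖ ≤ 1) {δ : ℝ} {k : ℕ} (hk : n - δ ≤ ‖Sg x k‖) :
    ∃ g : X →L[ℝ] ℝ, ‖g‖ ≤ 1 ∧ ∀ j : Fin n, |g (x j) - (if (j:ℕ) < k then (-1:ℝ) else 1)| ≤ δ := by
  obtain ⟨g, hg1, hg2⟩ := exists_dual_vector'' ℝ (Sg x k)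
  refine ⟨g, hg1, ?_⟩
  have hb : ∀ j, |g (x j)| ≤ 1 := by
    intro j
    have := g.le_opNorm (x j)
    rw [Real.norm_eq_abs] at this
    refine this.trans ?_
    exact mul_le_one₀ hg1 (norm_nonneg _) (hx j)
  let t : Fin n → ℝ := fun j => 1 - (if (j:ℕ) < k then (-1:ℝ) else 1) * g (x j)
  have ht : ∀ j, 0 ≤ t j := by
    intro j
    have := abs_le.1 (hb j)
    simp only [t]
    split_ifs <;> linarith
  have hsum : ∑ j, t j ≤ δ := by
    simp only [t, Finset.sum_sub_distrib, Finset.sum_const, Finset.card_univ, Fintype.card_fin, nsmul_eq_mul, mul_one]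
    have : g (Sg x k) = ∑ j : Fin n, (if (j:ℕ) < k then (-1:ℝ) else 1) * g (x j) := by
      simp only [Sg, map_sum, map_smul, smul_eq_mul]
    rw [← this, hg2]
    simp only [RCLike.ofReal_real_eq_id, id]
    linarith
  intro j
  have h1 := (Finset.single_le_sum (fun j _ => ht j) (Finset.mem_univ j)).trans hsum
  have h2 := ht j
  have h3 := abs_le.1 (hb j)
  simp only [t] at h1 h2
  rw [abs_le]
  split_ifs at * <;> constructor <;> linarith

theorem tree_system {ε : ℝ} (hε : 0 < ε) (hB : ∀ n, (Bder X ε n).Nonempty) (h : ℕ) {δ : ℝ} (hδ : 0 < δ) :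
    ∃ x : List Bool → X, (∀ w, ‖x w‖ ≤ 1) ∧ ∀ p : List Bool, p.length ≤ h → ∃ g : X →L[ℝ] ℝ, ‖g‖ ≤ 1 ∧
      ∀ w : List Bool, w.length ≤ h → |g (x w) - (if p <+: w then (1:ℝ) else 0)| ≤ δ := by
  obtain ⟨x, hx1, hx2⟩ := signs_exist hε hB (n := 3^h) (Nat.one_le_pow _ _ (by norm_num)) hδ
  refine ⟨fun w => x ⟨tidx h w, tidx_lt h w⟩, fun w => hx1 _, ?_⟩
  intro p hp
  have hle := tidx_add_le h p hp
  obtain ⟨g1, hg1, hg1'⟩ := sgn_functional hx1 (hx2 (tidx h p) (tidx_lt h p).le)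
  obtain ⟨g2, hg2, hg2'⟩ := sgn_functional hx1 (hx2 _ hle)
  refine ⟨(2⁻¹:ℝ) • (g1 - g2), ?_, ?_⟩
  · rw [norm_smul]
    have := norm_sub_le g1 g2
    norm_num
    linarith
  · intro w hw
    have e1 := abs_le.1 (hg1' ⟨tidx h w, tidx_lt h w⟩)
    have e2 := abs_le.1 (hg2' ⟨tidx h w, tidx_lt h w⟩)
    simp only [tidx_prefix h p w hp hw]
    simp only [ContinuousLinearMap.smul_apply, ContinuousLinearMap.sub_apply, smul_eq_mul]
    simp only at e1 e2
    have h3 : 0 < 3^(h - p.length) := by positivity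
    rw [abs_le]
    by_cases c1 : tidx h w < tidx h p
    · rw [if_pos c1] at e1
      rw [if_pos (by omega)] at e2
      rw [if_neg (by omega)]
      constructor <;> linarith [e1.1, e1.2, e2.1, e2.2]
    · rw [if_neg c1] at e1
      by_cases c2 : tidx h w < tidx h p + 3^(h - p.length)
      · rw [if_pos c2] at e2
        rw [if_pos ⟨by omega, c2⟩]
        constructor <;> linarith [e1.1, e1.2, e2.1, e2.2]
      · rw [if_neg c2] at e2
        rw [if_neg (by omega)]
        constructor <;> linarith [e1.1, e1.2, e2.1, e2.2]
end
section
variable {n : ℕ}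

/-- `v` is obtained from `u` by moving one step clockwise, possibly toggling the lamp at the new position. -/
def LAdj (u v : Lamp n) : Prop := v.2 = u.2 + 1 ∧ ∀ z, z ≠ v.2 → (z ∈ u.1 ↔ z ∈ v.1)

theorem lampMul_T (u : Lamp n) : lampMul u (lampT n) = (u.1, u.2 + 1) := by
  simp [lampMul, lampT]

theorem lampTA_eq : lampTA n = ({1}, 1) := by
  simp [lampTA, lampMul, lampT, lampA]

theorem lampMul_TA (u : Lamp n) : lampMul u (lampTA n) = (u.1 ∆ {u.2 + 1}, u.2 + 1) := by
  simp [lampMul, lampTA_eq]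

theorem lampMul_Tinv (u : Lamp n) : lampMul u (lampInv (lampT n)) = (u.1, u.2 - 1) := by
  simp [lampMul, lampInv, lampT, sub_eq_add_neg]

theorem lampMul_TAinv (u : Lamp n) : lampMul u (lampInv (lampTA n)) = (u.1 ∆ {u.2}, u.2 - 1) := by
  simp [lampMul, lampInv, lampTA_eq, sub_eq_add_neg]

/-- A generator letter. -/
def IsLetter (s : Lamp n) : Prop :=
  s ∈ ({lampT n, lampTA n} : Set (Lamp n)) ∨ ∃ g ∈ ({lampT n, lampTA n} : Set (Lamp n)), s = lampInv g

theorem letter_adj {s : Lamp n} (hs : IsLetter s) (u : Lamp n) : LAdj u (lampMul u s) ∨ LAdj (lampMul u s) u := by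
  rcases hs with hs | ⟨g, hg, rfl⟩
  · left
    simp only [Set.mem_insert_iff, Set.mem_singleton_iff] at hs
    rcases hs with rfl | rfl
    · rw [lampMul_T]; exact ⟨rfl, fun z _ => Iff.rfl⟩
    · rw [lampMul_TA]
      refine ⟨rfl, fun z hz => ?_⟩
      simp only at hz
      simp [Set.mem_symmDiff, hz]
  · right
    simp only [Set.mem_insert_iff, Set.mem_singleton_iff] at hg
    rcases hg with rfl | rfl
    · rw [lampMul_Tinv]; exact ⟨by simp, fun z _ => Iff.rfl⟩
    · rw [lampMul_TAinv]
      refine ⟨by simp, fun z hz => ?_⟩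
      simp [Set.mem_symmDiff, hz]

theorem adj_letter {u v : Lamp n} (h : LAdj u v) : ∃ s, IsLetter s ∧ v = lampMul u s := by
  obtain ⟨h1, h2⟩ := h
  by_cases hz : v.2 ∈ u.1 ↔ v.2 ∈ v.1
  · refine ⟨lampT n, Or.inl (by simp), ?_⟩
    rw [lampMul_T]
    refine Prod.ext ?_ h1
    ext z
    by_cases hzv : z = v.2
    · subst hzv; exact hz.symm
    · exact (h2 z hzv).symm
  · refine ⟨lampTA n, Or.inl (by simp), ?_⟩
    rw [lampMul_TA]
    refine Prod.ext ?_ h1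
    ext z
    rw [← h1]
    by_cases hzv : z = v.2
    · subst hzv
      simp [Set.mem_symmDiff]; tauto
    · simp [Set.mem_symmDiff, hzv, (h2 z hzv)]

theorem adj_letter' {u v : Lamp n} (h : LAdj u v) : ∃ s, IsLetter s ∧ u = lampMul v s := by
  obtain ⟨h1, h2⟩ := h
  have h3 : u.2 = v.2 - 1 := by rw [h1]; simp
  by_cases hz : v.2 ∈ u.1 ↔ v.2 ∈ v.1
  · refine ⟨lampInv (lampT n), Or.inr ⟨_, by simp, rfl⟩, ?_⟩
    rw [lampMul_Tinv]
    refine Prod.ext ?_ h3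
    ext z
    by_cases hzv : z = v.2
    · subst hzv; exact hz
    · exact (h2 z hzv)
  · refine ⟨lampInv (lampTA n), Or.inr ⟨_, by simp, rfl⟩, ?_⟩
    rw [lampMul_TAinv]
    refine Prod.ext ?_ h3
    ext z
    by_cases hzv : z = v.2
    · subst hzv
      simp [Set.mem_symmDiff]; tauto
    · simp [Set.mem_symmDiff, hzv, (h2 z hzv)]

/-- Walks of length `m`. -/
def Wk : ℕ → Lamp n → Lamp n → Prop
  | 0, u, v => u = v
  | m+1, u, v => ∃ z, (LAdj u z ∨ LAdj z u) ∧ Wk m z v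

theorem Wk_trans {m m' : ℕ} : ∀ {u v z : Lamp n}, Wk m u v → Wk m' v z → Wk (m+m') u z := by
  induction m with
  | zero => intro u v z h h'; simp only [Wk] at h; subst h; simpa using h'
  | succ m ih =>
    rintro u v z ⟨y, hy, h⟩ h'
    rw [Nat.succ_add]
    exact ⟨y, hy, ih h h'⟩

theorem Wk_symm {m : ℕ} : ∀ {u v : Lamp n}, Wk m u v → Wk m v u := by
  induction m with
  | zero => intro u v h; exact h.symm
  | succ m ih =>
    rintro u v ⟨y, hy, h⟩
    exact Wk_trans (ih h) (m' := 1) ⟨u, hy.symm, rfl⟩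

theorem Wk_iff (m : ℕ) : ∀ (u v : Lamp n), Wk m u v ↔ ∃ w : List (Lamp n), w.length = m ∧ (∀ s ∈ w, IsLetter s) ∧ v = w.foldl lampMul u := by
  induction m with
  | zero =>
    intro u v
    constructor
    · intro h; exact ⟨[], rfl, by simp, by simpa using h.symm⟩
    · rintro ⟨w, hw, _, h⟩
      rw [List.length_eq_zero_iff] at hw
      subst hw
      exact h.symm
  | succ m ih =>
    intro u v
    constructor
    · rintro ⟨z, hz, h⟩
      obtain ⟨w, hw, hl, he⟩ := (ih _ _).1 h
      have : ∃ s, IsLetter s ∧ z = lampMul u s := by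
        rcases hz with hz | hz
        · exact adj_letter hz
        · exact adj_letter' hz
      obtain ⟨s, hs, rfl⟩ := this
      refine ⟨s :: w, by simp [hw], ?_, by simpa using he⟩
      intro s' hs'
      rw [List.mem_cons] at hs'
      rcases hs' with rfl | hs'
      · exact hs
      · exact hl _ hs'
    · rintro ⟨w, hw, hl, he⟩
      obtain ⟨s, w, rfl⟩ := List.exists_cons_of_length_eq_add_one hw
      refine ⟨lampMul u s, letter_adj (hl s (by simp)) u, (ih _ _).2 ⟨w, by simpa using hw, ?_, by simpa using he⟩⟩
      intro s' hs'
      exact hl _ (List.mem_cons_of_mem _ hs')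

theorem lampDist_eq (u v : Lamp n) : lampDist n u v = sInf {m | Wk m u v} := by
  unfold lampDist wordDist
  congr 1
  ext m
  exact (Wk_iff m u v).symm

theorem lampDist_le {u v : Lamp n} {m : ℕ} (h : Wk m u v) : lampDist n u v ≤ m := by
  rw [lampDist_eq]; exact Nat.sInf_le h

theorem lampDist_wk {u v : Lamp n} {m : ℕ} (h : Wk m u v) : Wk (lampDist n u v) u v := by
  rw [lampDist_eq]; exact Nat.sInf_mem (s := {m | Wk m u v}) ⟨m, h⟩

theorem lampDist_symm (u v : Lamp n) : lampDist n u v = lampDist n v u := by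
  rw [lampDist_eq, lampDist_eq]
  congr 1
  ext m
  exact ⟨Wk_symm, Wk_symm⟩

theorem walk_right (d : ℕ) : ∀ (u : Lamp n) (y : Set (ZMod n)),
    (∀ z, (∀ i : ℕ, 1 ≤ i → i ≤ d → z ≠ u.2 + i) → (z ∈ u.1 ↔ z ∈ y)) → Wk d u (y, u.2 + d) := by
  induction d with
  | zero =>
    intro u y h
    refine Prod.ext ?_ (by simp)
    ext z
    exact h z (by intro i h1 h2; omega)
  | succ d ih =>
    intro u y h
    let u' : Lamp n := ({z | (z = u.2 + 1 ∧ z ∈ y) ∨ (z ≠ u.2 + 1 ∧ z ∈ u.1)}, u.2 + 1)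
    have hadj : LAdj u u' := by
      refine ⟨rfl, ?_⟩
      intro z hz
      change z ≠ u.2 + 1 at hz
      simp [u', hz]
    refine ⟨u', Or.inl hadj, ?_⟩
    have := ih u' y (by
      intro z hz
      by_cases h1 : z = u.2 + 1
      · simp [u', h1]
      · have h2 := h z (by
          intro i hi1 hi2
          rcases Nat.lt_or_ge 1 i with hi | hi
          · have := hz (i-1) (by omega) (by omega)
            intro he
            apply this
            rw [he]
            simp only [u']
            have : (i:ZMod n) = ((i - 1 + 1 : ℕ) : ZMod n) := by congr 1; omega
            rw [this]; push_cast; ring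
          · have : i = 1 := by omega
            subst this
            simpa using h1)
        simp [u', h1, h2])
    have e : u'.2 + (d : ZMod n) = u.2 + ((d+1 : ℕ) : ZMod n) := by
      simp only [u']; push_cast; ring
    rw [e] at this
    exact this

/-- Position relative to the cut `c`. -/
def rpos (c : ZMod n) (u : Lamp n) : ℕ := (u.2 - c).val

theorem rpos_lt [NeZero n] (c : ZMod n) (u : Lamp n) : rpos c u < n := ZMod.val_lt _

theorem rpos_eq [NeZero n] (c : ZMod n) (u : Lamp n) : u.2 = c + (rpos c u : ZMod n) := by
  simp [rpos]

open Classical in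
/-- State of the lamp on the `e`-th edge after the cut `c`. -/
noncomputable def bitf (c : ZMod n) (u : Lamp n) (e : ℕ) : Bool := decide (c + (e : ZMod n) ∈ u.1)

theorem exists_edge [NeZero n] (c z : ZMod n) : ∃ e : ℕ, 1 ≤ e ∧ e ≤ n ∧ z = c + e := by
  have hlt : (z - c - 1).val < n := ZMod.val_lt _
  refine ⟨(z - c - 1).val + 1, by omega, by omega, ?_⟩
  push_cast
  rw [ZMod.natCast_zmod_val]
  ring

theorem walk_full [NeZero n] (c : ZMod n) (u v : Lamp n) (a b : ℕ) (ha : a ≤ rpos c u)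
    (huv : rpos c u ≤ rpos c v) (hb : rpos c v ≤ b)
    (hag : ∀ e, 1 ≤ e → e ≤ n → (e ≤ a ∨ b < e) → bitf c u e = bitf c v e) :
    Wk ((rpos c u - a) + (b - a) + (b - rpos c v)) u v := by
  have h1 : Wk (rpos c u - a) (u.1, c + (a : ZMod n)) u := by
    have := walk_right (rpos c u - a) (u.1, c + (a : ZMod n)) u.1 (fun z _ => Iff.rfl)
    have e : (u.1, (u.1, c + (a : ZMod n)).2 + ((rpos c u - a : ℕ) : ZMod n)) = u := by
      refine Prod.ext rfl ?_
      simp only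
      rw [Nat.cast_sub ha]
      refine Eq.trans ?_ (rpos_eq c u).symm
      ring
    rwa [e] at this
  have h2 : Wk (b - a) (u.1, c + (a : ZMod n)) (v.1, c + (b : ZMod n)) := by
    have := walk_right (b - a) (u.1, c + (a : ZMod n)) v.1 (by
      intro z hz
      obtain ⟨e, he1, he2, rfl⟩ := exists_edge c z
      have := hag e he1 he2 (by
        by_contra hcon
        push Not at hcon
        apply hz (e - a) (by omega) (by omega)
        simp only
        rw [Nat.cast_sub (by omega)]; ring)
      simpa [bitf] using this)
    have e : (u.1, c + (a : ZMod n)).2 + ((b - a : ℕ) : ZMod n) = c + (b : ZMod n) := by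
      simp only
      rw [Nat.cast_sub (by omega)]; ring
    rwa [e] at this
  have h3 : Wk (b - rpos c v) v (v.1, c + (b : ZMod n)) := by
    have := walk_right (b - rpos c v) v v.1 (fun z _ => Iff.rfl)
    have e : v.2 + ((b - rpos c v : ℕ) : ZMod n) = c + (b : ZMod n) := by
      rw [Nat.cast_sub hb]
      nth_rewrite 1 [rpos_eq c v]; ring
    rwa [e] at this
  exact Wk_trans (Wk_trans (Wk_symm h1) h2) (Wk_symm h3)
end
section
variable {X : Type*} [NormedAddCommGroup X] [NormedSpace ℝ X] {n : ℕ}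

def pre (b : ℕ → Bool) (L : ℕ) : List Bool := (List.range L).map b

theorem pre_length (b : ℕ → Bool) (L : ℕ) : (pre b L).length = L := by simp [pre]

theorem pre_congr {b b' : ℕ → Bool} {L : ℕ} (h : ∀ i < L, b i = b' i) : pre b L = pre b' L := by
  apply List.map_congr_left
  intro i hi
  exact h i (List.mem_range.1 hi)

theorem pre_prefix {b b' : ℕ → Bool} {L L' : ℕ} (h : pre b L <+: pre b' L') : L ≤ L' ∧ ∀ i < L, b i = b' i := by
  have hl : L ≤ L' := by simpa [pre_length] using h.length_le
  refine ⟨hl, ?_⟩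
  intro i hi
  have h1 := h.getElem (i := i) (by rw [pre_length]; exact hi)
  simpa [pre] using h1

theorem prefix_pre (b : ℕ → Bool) {L L' : ℕ} (h : L ≤ L') : pre b L <+: pre b L' := by
  obtain ⟨d, rfl⟩ := Nat.exists_eq_add_of_le h
  unfold pre
  rw [List.range_add, List.map_append]
  exact List.prefix_append _ _

def TT (x : List Bool → X) (tag : List Bool) (b : ℕ → Bool) (L : ℕ) : X :=
  ∑ i ∈ Finset.range L, x (tag ++ pre b (i+1))

theorem TT_norm {x : List Bool → X} (hx : ∀ w, ‖x w‖ ≤ 1) (tag : List Bool) (b : ℕ → Bool) (L : ℕ) :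
    ‖TT x tag b L‖ ≤ L := by
  refine (norm_sum_le _ _).trans ((Finset.sum_le_sum (fun i _ => hx _)).trans ?_)
  simp

theorem TT_step {x : List Bool → X} (hx : ∀ w, ‖x w‖ ≤ 1) (tag : List Bool) {b b' : ℕ → Bool} {L : ℕ}
    (h : ∀ i < L, b i = b' i) {s t : ℝ} (hst : |s - t| * L ≤ 1) (ht : |t| ≤ 1) :
    ‖s • TT x tag b L - t • TT x tag b' (L+1)‖ ≤ 2 := by
  have e : TT x tag b' (L+1) = TT x tag b L + x (tag ++ pre b' (L+1)) := by
    unfold TT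
    rw [Finset.sum_range_succ]
    congr 1
    apply Finset.sum_congr rfl
    intro i hi
    rw [Finset.mem_range] at hi
    rw [pre_congr (fun j hj => (h j (by omega)))]
  rw [e, smul_add, ← sub_sub, ← sub_smul]
  have h1 : ‖(s - t) • TT x tag b L‖ ≤ 1 := by
    rw [norm_smul, Real.norm_eq_abs]
    exact (mul_le_mul_of_nonneg_left (TT_norm hx tag b L) (abs_nonneg _)).trans hst
  have h2 : ‖t • x (tag ++ pre b' (L+1))‖ ≤ 1 := by
    rw [norm_smul, Real.norm_eq_abs]
    exact mul_le_one₀ ht (norm_nonneg _) (hx _)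
  have := norm_sub_le ((s - t) • TT x tag b L) (t • x (tag ++ pre b' (L+1)))
  linarith

/-- Length of the word (clockwise or counterclockwise). -/
def clen (c : ZMod n) (s : Bool) (u : Lamp n) : ℕ := if s then rpos c u else n - rpos c u

noncomputable def cwt (c : ZMod n) (s : Bool) (u : Lamp n) : ℝ :=
  if s then ((n:ℝ) - rpos c u) / n else ((rpos c u : ℝ) + 1) / n

noncomputable def cfb (c : ZMod n) (s : Bool) (u : Lamp n) (i : ℕ) : Bool :=
  if s then bitf c u (i+1) else bitf c u (n - i)

noncomputable def comp1 (x : List Bool → X) (tag : List Bool) (c : ZMod n) (s : Bool) (u : Lamp n) : X :=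
  cwt c s u • TT x tag (cfb c s u) (clen c s u)

theorem clen_le [NeZero n] (c : ZMod n) (s : Bool) (u : Lamp n) : clen c s u ≤ n := by
  have := rpos_lt c u
  unfold clen
  split_ifs <;> omega

theorem cwt_bd [NeZero n] (c : ZMod n) (s : Bool) (u : Lamp n) : 0 ≤ cwt c s u ∧ cwt c s u ≤ 1 := by
  have h1 := rpos_lt c u
  have h2 : (rpos c u : ℝ) + 1 ≤ n := by exact_mod_cast h1
  have h3 : (0:ℝ) ≤ rpos c u := Nat.cast_nonneg _
  have h4 : (0:ℝ) < n := by linarith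
  unfold cwt
  split_ifs
  · exact ⟨div_nonneg (by linarith) h4.le, (div_le_one h4).2 (by linarith)⟩
  · exact ⟨div_nonneg (by linarith) h4.le, (div_le_one h4).2 (by linarith)⟩

theorem natCast_ne {n : ℕ} {c : ZMod n} {e f : ℕ} (h : e < f) (h2 : f < e + n) : c + (e : ZMod n) ≠ c + (f : ZMod n) := by
  intro he
  have h3 := add_left_cancel he
  rw [ZMod.natCast_eq_natCast_iff] at h3
  rw [Nat.modEq_iff_dvd' h.le] at h3
  have := Nat.le_of_dvd (by omega) h3
  omega

theorem rpos_step [NeZero n] (c : ZMod n) {u v : Lamp n} (h : v.2 = u.2 + 1) :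
    (rpos c u + 1 < n ∧ rpos c v = rpos c u + 1) ∨ (rpos c u + 1 = n ∧ rpos c v = 0) := by
  have h1 := rpos_lt c u
  have e : v.2 - c = ((rpos c u + 1 : ℕ) : ZMod n) := by
    rw [h]
    nth_rewrite 1 [rpos_eq c u]
    push_cast; ring
  rcases Nat.lt_or_ge (rpos c u + 1) n with h2 | h2
  · left
    refine ⟨h2, ?_⟩
    unfold rpos at *
    rw [e, ZMod.val_cast_of_lt h2]
  · right
    have h3 : rpos c u + 1 = n := by omega
    refine ⟨h3, ?_⟩
    rw [h3] at e
    change (v.2 - c).val = 0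
    rw [e]; simp

theorem comp1_lip [NeZero n] {x : List Bool → X} (hx : ∀ w, ‖x w‖ ≤ 1) (tag : List Bool) (c : ZMod n) (s : Bool)
    {u v : Lamp n} (h : LAdj u v) : ‖comp1 x tag c s u - comp1 x tag c s v‖ ≤ 2 := by
  have hn0 : 0 < n := NeZero.pos n
  have hn : (0:ℝ) < n := by exact_mod_cast hn0
  have hu := rpos_lt c u
  have hbit : ∀ e : ℕ, c + (e : ZMod n) ≠ c + ((rpos c u + 1 : ℕ) : ZMod n) → bitf c u e = bitf c v e := by
    intro e he
    have h1 : c + (e : ZMod n) ≠ v.2 := by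
      rw [h.1, rpos_eq c u]
      intro h2; apply he; rw [h2]; push_cast; ring
    have := h.2 _ h1
    simp [bitf, this]
  rcases rpos_step c h.1 with ⟨h1, h2⟩ | ⟨h1, h2⟩
  · cases s with
    | true =>
      simp only [comp1, clen, cwt, cfb, if_true, h2]
      apply TT_step hx
      · intro i hi
        apply hbit
        exact natCast_ne (by omega) (by omega)
      · push_cast
        have : ((n:ℝ) - rpos c u) / n - (n - (rpos c u + 1)) / n = 1 / n := by ring
        rw [this, abs_of_nonneg (by positivity), one_div, inv_mul_le_iff₀ hn, mul_one]
        exact_mod_cast hu.le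
      · have := cwt_bd c true v
        simp only [cwt, if_true, h2] at this
        exact abs_le.2 ⟨by linarith [this.1], this.2⟩
    | false =>
      simp only [comp1, clen, cwt, cfb, Bool.false_eq_true, if_false, h2]
      have e : n - rpos c u = (n - (rpos c u + 1)) + 1 := by omega
      rw [norm_sub_rev, e]
      apply TT_step hx
      · intro i hi
        symm
        apply hbit
        exact (natCast_ne (by omega) (by omega)).symm
      · push_cast
        have : ((rpos c u : ℝ) + 1 + 1) / n - (rpos c u + 1) / n = 1 / n := by ring
        rw [this, abs_of_nonneg (by positivity), one_div, inv_mul_le_iff₀ hn, mul_one]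
        exact_mod_cast Nat.sub_le _ _
      · have := cwt_bd c false u
        simp only [cwt, Bool.false_eq_true, if_false] at this
        exact abs_le.2 ⟨by linarith [this.1], this.2⟩
  · have key : ∀ w : Lamp n, cwt c s w * clen c s w ≤ 1 → ‖comp1 x tag c s w‖ ≤ 1 := by
      intro w hw
      have h3 := (cwt_bd c s w).1
      rw [comp1, norm_smul, Real.norm_of_nonneg h3]
      exact (mul_le_mul_of_nonneg_left (TT_norm hx _ _ _) h3).trans hw
    have hu1 : (rpos c u : ℝ) + 1 = n := by exact_mod_cast h1
    have k1 : ‖comp1 x tag c s u‖ ≤ 1 := by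
      apply key
      cases s with
      | true =>
        simp only [clen, cwt, if_true]
        rw [div_mul_eq_mul_div, div_le_one hn]
        nlinarith
      | false =>
        simp only [clen, cwt, Bool.false_eq_true, if_false]
        have e : n - rpos c u = 1 := by omega
        rw [e, hu1]
        simp [hn.ne']
    have k2 : ‖comp1 x tag c s v‖ ≤ 1 := by
      apply key
      cases s with
      | true => simp [clen, cwt, h2]
      | false => simp [clen, cwt, h2, hn.ne']
    have := norm_sub_le (comp1 x tag c s u) (comp1 x tag c s v)
    linarith

/-- Tags separating the six components. -/
def ctag (J : Fin 3 × Bool) : List Bool := [J.2, decide (J.1 = 1), decide (J.1 = 2)]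

theorem ctag_inj : ∀ J J', ctag J = ctag J' → J = J' := by decide

noncomputable def FF (x : List Bool → X) (cut : Fin 3 → ZMod n) (u : Lamp n) : X :=
  ∑ J : Fin 3 × Bool, comp1 x (ctag J) (cut J.1) J.2 u

theorem FF_adj [NeZero n] {x : List Bool → X} (hx : ∀ w, ‖x w‖ ≤ 1) (cut : Fin 3 → ZMod n) {u v : Lamp n} (h : LAdj u v) :
    ‖FF x cut u - FF x cut v‖ ≤ 12 := by
  unfold FF
  rw [← Finset.sum_sub_distrib]
  refine (norm_sum_le _ _).trans ((Finset.sum_le_sum (fun J _ => comp1_lip hx _ _ _ h)).trans ?_)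
  simp; norm_num

theorem FF_lip [NeZero n] {x : List Bool → X} (hx : ∀ w, ‖x w‖ ≤ 1) (cut : Fin 3 → ZMod n) (m : ℕ) :
    ∀ {u v : Lamp n}, Wk m u v → ‖FF x cut u - FF x cut v‖ ≤ 12 * m := by
  induction m with
  | zero => intro u v h; simp only [Wk] at h; subst h; simp
  | succ m ih =>
    rintro u v ⟨z, hz, h⟩
    have h1 : ‖FF x cut u - FF x cut z‖ ≤ 12 := by
      rcases hz with hz | hz
      · exact FF_adj hx cut hz
      · rw [norm_sub_rev]; exact FF_adj hx cut hz
    have h2 := ih h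
    have := norm_sub_le_norm_sub_add_norm_sub (FF x cut u) (FF x cut z) (FF x cut v)
    push_cast
    linarith

theorem eval_TT {x : List Bool → X} {g : X →L[ℝ] ℝ} {δ : ℝ} {h : ℕ} {P : List Bool}
    (hg : ∀ w : List Bool, w.length ≤ h → |g (x w) - (if P <+: w then (1:ℝ) else 0)| ≤ δ)
    (tag : List Bool) (b : ℕ → Bool) (L : ℕ) (hL : tag.length + L ≤ h) :
    |g (TT x tag b L) - ((Finset.range L).filter (fun i => P <+: tag ++ pre b (i+1))).card| ≤ δ * L := by
  have e : g (TT x tag b L) - ((Finset.range L).filter (fun i => P <+: tag ++ pre b (i+1))).card =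
      ∑ i ∈ Finset.range L, (g (x (tag ++ pre b (i+1))) - (if P <+: tag ++ pre b (i+1) then (1:ℝ) else 0)) := by
    rw [Finset.sum_sub_distrib, TT, map_sum]
    simp
  rw [e]
  refine (Finset.abs_sum_le_sum_abs _ _).trans ?_
  have : ∑ i ∈ Finset.range L, |g (x (tag ++ pre b (i+1))) - (if P <+: tag ++ pre b (i+1) then (1:ℝ) else 0)| ≤
      ∑ i ∈ Finset.range L, δ := by
    apply Finset.sum_le_sum
    intro i hi
    rw [Finset.mem_range] at hi
    apply hg
    rw [List.length_append, pre_length]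
    omega
  refine this.trans ?_
  simp [mul_comm]

theorem eval_FF [NeZero n] {x : List Bool → X} {g : X →L[ℝ] ℝ} {δ : ℝ} (hδ : 0 ≤ δ) {P : List Bool}
    (hg : ∀ w : List Bool, w.length ≤ n+3 → |g (x w) - (if P <+: w then (1:ℝ) else 0)| ≤ δ)
    (cut : Fin 3 → ZMod n) (u : Lamp n) (J : Fin 3 × Bool) {p : List Bool} (hP : P = ctag J ++ p) :
    |g (FF x cut u) - cwt (cut J.1) J.2 u *
      ((Finset.range (clen (cut J.1) J.2 u)).filter (fun i => p <+: pre (cfb (cut J.1) J.2 u) (i+1))).card| ≤ 6 * n * δ := by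
  let K : Fin 3 × Bool → ℝ := fun J' => cwt (cut J'.1) J'.2 u *
      ((Finset.range (clen (cut J'.1) J'.2 u)).filter (fun i => P <+: ctag J' ++ pre (cfb (cut J'.1) J'.2 u) (i+1))).card
  have h1 : ∀ J', |g (comp1 x (ctag J') (cut J'.1) J'.2 u) - K J'| ≤ n * δ := by
    intro J'
    have hb := cwt_bd (cut J'.1) J'.2 u
    have hl := clen_le (cut J'.1) J'.2 u
    have he := eval_TT hg (ctag J') (cfb (cut J'.1) J'.2 u) (clen (cut J'.1) J'.2 u) (by simp [ctag]; omega)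
    simp only [comp1, map_smul, smul_eq_mul, K]
    rw [← mul_sub, abs_mul, abs_of_nonneg hb.1]
    refine (mul_le_mul hb.2 he (abs_nonneg _) (by norm_num)).trans ?_
    have : (clen (cut J'.1) J'.2 u : ℝ) ≤ n := by exact_mod_cast hl
    nlinarith
  have h2 : K J = cwt (cut J.1) J.2 u *
      ((Finset.range (clen (cut J.1) J.2 u)).filter (fun i => p <+: pre (cfb (cut J.1) J.2 u) (i+1))).card := by
    simp only [K, hP, List.prefix_append_right_inj]
  have h3 : ∑ J', K J' = K J := by
    apply Finset.sum_eq_single_of_mem J (Finset.mem_univ _)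
    intro J' _ hJ
    have : (Finset.range (clen (cut J'.1) J'.2 u)).filter (fun i => P <+: ctag J' ++ pre (cfb (cut J'.1) J'.2 u) (i+1)) = ∅ := by
      rw [Finset.filter_eq_empty_iff]
      intro i _ hcon
      apply hJ
      rw [hP] at hcon
      have h4 : ctag J <+: ctag J' ++ pre (cfb (cut J'.1) J'.2 u) (i+1) := (List.prefix_append _ _).trans hcon
      have h5 : ctag J <+: ctag J' := List.prefix_of_prefix_length_le h4 (List.prefix_append _ _) (by simp [ctag])
      exact (ctag_inj _ _ (h5.eq_of_length (by simp [ctag]))).symm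
    simp only [K, this]
    simp
  rw [← h2, ← h3, FF, map_sum, ← Finset.sum_sub_distrib]
  refine (Finset.abs_sum_le_sum_abs _ _).trans ((Finset.sum_le_sum (fun J' _ => h1 J')).trans ?_)
  simp; linarith

theorem FF_lower [NeZero n] {x : List Bool → X} {δ : ℝ} (hδ : 0 ≤ δ)
    (hx : ∀ p : List Bool, p.length ≤ n+3 → ∃ g : X →L[ℝ] ℝ, ‖g‖ ≤ 1 ∧
      ∀ w : List Bool, w.length ≤ n+3 → |g (x w) - (if p <+: w then (1:ℝ) else 0)| ≤ δ)
    (cut : Fin 3 → ZMod n) (J : Fin 3 × Bool) (u v : Lamp n) (a : ℕ)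
    (ha : a ≤ clen (cut J.1) J.2 v)
    (hd : a < clen (cut J.1) J.2 u → cfb (cut J.1) J.2 u a ≠ cfb (cut J.1) J.2 v a) :
    cwt (cut J.1) J.2 v * (clen (cut J.1) J.2 v - a) ≤ ‖FF x cut u - FF x cut v‖ + 12 * n * δ := by
  have hn0 : (0:ℝ) ≤ n := Nat.cast_nonneg _
  rcases ha.eq_or_lt with ha | ha
  · rw [ha, sub_self, mul_zero]; positivity
  have hl := clen_le (cut J.1) J.2 v
  set bv := cfb (cut J.1) J.2 v with hbv
  set bu := cfb (cut J.1) J.2 u with hbu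
  obtain ⟨g, hg1, hg2⟩ := hx (ctag J ++ pre bv (a+1)) (by rw [List.length_append, pre_length]; simp [ctag]; omega)
  have hu := eval_FF hδ hg2 cut u J rfl
  have hv := eval_FF hδ hg2 cut v J rfl
  rw [← hbu] at hu
  rw [← hbv] at hv
  have e1 : (Finset.range (clen (cut J.1) J.2 u)).filter (fun i => pre bv (a+1) <+: pre bu (i+1)) = ∅ := by
    rw [Finset.filter_eq_empty_iff]
    intro i hi hcon
    rw [Finset.mem_range] at hi
    obtain ⟨h1, h2⟩ := pre_prefix hcon
    exact hd (by omega) (h2 a (by omega)).symm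
  have e2 : (Finset.range (clen (cut J.1) J.2 v)).filter (fun i => pre bv (a+1) <+: pre bv (i+1)) = Finset.Ico a (clen (cut J.1) J.2 v) := by
    ext i
    simp only [Finset.mem_filter, Finset.mem_range, Finset.mem_Ico]
    constructor
    · rintro ⟨h1, h2⟩
      have := (pre_prefix h2).1
      omega
    · rintro ⟨h1, h2⟩
      exact ⟨h2, prefix_pre _ (by omega)⟩
  rw [e1] at hu
  rw [e2, Nat.card_Ico, Nat.cast_sub ha.le] at hv
  simp only [Finset.card_empty, Nat.cast_zero, mul_zero, sub_zero] at hu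
  have h3 : g (FF x cut v) - g (FF x cut u) ≤ ‖FF x cut u - FF x cut v‖ := by
    rw [← map_sub, norm_sub_rev]
    refine (le_abs_self _).trans ?_
    have := g.le_opNorm (FF x cut v - FF x cut u)
    rw [Real.norm_eq_abs] at this
    refine this.trans ?_
    exact mul_le_of_le_one_left (norm_nonneg _) hg1
  have h4 := abs_le.1 hu
  have h5 := abs_le.1 hv
  linarith [h4.1, h4.2, h5.1, h5.2]
end
section
variable {X : Type*} [NormedAddCommGroup X] [NormedSpace ℝ X] {n : ℕ}

theorem first_fail (P : ℕ → Prop) (L : ℕ) : ∃ a ≤ L, (∀ i < a, P i) ∧ (a < L → ¬ P a) := by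
  induction L with
  | zero => exact ⟨0, le_rfl, by intro i hi; omega, by intro h; omega⟩
  | succ L ih =>
    obtain ⟨a, h1, h2, h3⟩ := ih
    rcases h1.lt_or_eq with h | h
    · exact ⟨a, by omega, h2, fun _ => h3 h⟩
    · by_cases hP : P L
      · refine ⟨L+1, le_rfl, ?_, by intro h; omega⟩
        intro i hi
        rcases Nat.lt_or_ge i L with h4 | h4
        · exact h2 i (by omega)
        · have : i = L := by omega
          rwa [this]
      · exact ⟨a, by omega, h2, fun _ => by rwa [h]⟩

theorem core_lower [NeZero n] {x : List Bool → X} {δ : ℝ} (hδ : 0 ≤ δ)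
    (hx : ∀ p : List Bool, p.length ≤ n+3 → ∃ g : X →L[ℝ] ℝ, ‖g‖ ≤ 1 ∧
      ∀ w : List Bool, w.length ≤ n+3 → |g (x w) - (if p <+: w then (1:ℝ) else 0)| ≤ δ)
    (cut : Fin 3 → ZMod n) (j : Fin 3) (u v : Lamp n) (huv : rpos (cut j) u ≤ rpos (cut j) v)
    (h1 : n ≤ 12 * (rpos (cut j) u + 1)) (h2 : n ≤ 12 * (n - rpos (cut j) v)) :
    ∃ m : ℕ, Wk m u v ∧ (m : ℝ) ≤ 48 * (‖FF x cut u - FF x cut v‖ + 12 * n * δ) := by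
  have hn0 : 0 < n := NeZero.pos n
  have hn : (0:ℝ) < n := by exact_mod_cast hn0
  have hu := rpos_lt (cut j) u
  have hv := rpos_lt (cut j) v
  obtain ⟨a, ha1, ha2, ha3⟩ := first_fail (fun i => bitf (cut j) u (i+1) = bitf (cut j) v (i+1)) (rpos (cut j) u)
  obtain ⟨a', hb1, hb2, hb3⟩ := first_fail (fun i => bitf (cut j) v (n-i) = bitf (cut j) u (n-i)) (n - rpos (cut j) v)
  have hw := walk_full (cut j) u v a (n - a') ha1 huv (by omega) (by
    intro e he1 he2 he
    rcases he with he | he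
    · have := ha2 (e-1) (by omega)
      rwa [Nat.sub_add_cancel he1] at this
    · have := hb2 (n-e) (by omega)
      have e1 : n - (n - e) = e := by omega
      rw [e1] at this
      exact this.symm)
  refine ⟨_, hw, ?_⟩
  set E := ‖FF x cut u - FF x cut v‖ + 12 * n * δ with hE
  have l1 := FF_lower hδ hx cut (j, true) u v a (by simp only [clen, if_true]; omega)
    (by simp only [clen, cfb, if_true]; exact ha3)
  have l2 := FF_lower hδ hx cut (j, false) v u a' (by simp only [clen, Bool.false_eq_true, if_false]; omega)
    (by simp only [clen, cfb, Bool.false_eq_true, if_false]; exact hb3)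
  rw [norm_sub_rev] at l2
  rw [← hE] at l1 l2
  simp only [clen, cwt, if_true, Bool.false_eq_true, if_false] at l1 l2
  have w1 : (1:ℝ)/12 ≤ (n - rpos (cut j) v) / n := by
    rw [div_le_div_iff₀ (by norm_num) hn]
    have : (n:ℝ) ≤ 12 * ((n - rpos (cut j) v : ℕ) : ℝ) := by exact_mod_cast h2
    rw [Nat.cast_sub hv.le] at this
    linarith
  have w2 : (1:ℝ)/12 ≤ ((rpos (cut j) u : ℝ) + 1) / n := by
    rw [div_le_div_iff₀ (by norm_num) hn]
    have : (n:ℝ) ≤ 12 * ((rpos (cut j) u : ℝ) + 1) := by exact_mod_cast h1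
    linarith
  rw [Nat.cast_sub hu.le] at l2
  have p1 : (0:ℝ) ≤ rpos (cut j) v - a := by
    have : (a:ℝ) ≤ rpos (cut j) v := by exact_mod_cast ha1.trans huv
    linarith
  have p2 : (0:ℝ) ≤ n - rpos (cut j) u - a' := by
    have : ((a' + rpos (cut j) u : ℕ) : ℝ) ≤ n := by exact_mod_cast (by omega : a' + rpos (cut j) u ≤ n)
    push_cast at this
    linarith
  have q1 := (mul_le_mul_of_nonneg_right w1 p1).trans l1
  have q2 := (mul_le_mul_of_nonneg_right w2 p2).trans l2
  have huv' : (rpos (cut j) u : ℝ) ≤ rpos (cut j) v := by exact_mod_cast huv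
  have e : (((rpos (cut j) u - a) + ((n - a') - a) + ((n - a') - rpos (cut j) v) : ℕ) : ℝ) =
      2 * (n - a') - 2 * a + rpos (cut j) u - rpos (cut j) v := by
    have k1 : ((rpos (cut j) u - a : ℕ) : ℝ) = (rpos (cut j) u : ℝ) - a := Nat.cast_sub ha1
    have k2 : (((n - a') : ℕ) : ℝ) = (n : ℝ) - a' := Nat.cast_sub (by omega)
    have k3 : (((n - a') - a : ℕ) : ℝ) = ((n - a' : ℕ) : ℝ) - a := Nat.cast_sub (by omega)
    have k4 : (((n - a') - rpos (cut j) v : ℕ) : ℝ) = ((n - a' : ℕ) : ℝ) - rpos (cut j) v :=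
      Nat.cast_sub (by omega)
    rw [Nat.cast_add, Nat.cast_add, k1, k3, k4, k2]
    ring
  rw [e]
  linarith

theorem rpos_cast [NeZero n] (C : ℕ) (hC : C < n) (u : Lamp n) :
    rpos (C : ZMod n) u = if C ≤ u.2.val then u.2.val - C else u.2.val + n - C := by
  have hK : u.2.val < n := ZMod.val_lt _
  have e : u.2 = ((u.2.val : ℕ) : ZMod n) := by simp
  unfold rpos
  split_ifs with h
  · have : u.2 - (C : ZMod n) = ((u.2.val - C : ℕ) : ZMod n) := by
      rw [Nat.cast_sub h, ← e]
    rw [this, ZMod.val_cast_of_lt (by omega)]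
  · have : u.2 - (C : ZMod n) = ((u.2.val + n - C : ℕ) : ZMod n) := by
      rw [Nat.cast_sub (by omega), Nat.cast_add, ← e]; simp
    rw [this, ZMod.val_cast_of_lt (by omega)]

def cuts (n : ℕ) (j : Fin 3) : ZMod n := ((j.val * (n/3) : ℕ) : ZMod n)

theorem good_one [NeZero n] (u : Lamp n) {i j : Fin 3} (hij : i < j) :
    (n ≤ 12 * (rpos (cuts n i) u + 1) ∧ n ≤ 12 * (n - rpos (cuts n i) u)) ∨
    (n ≤ 12 * (rpos (cuts n j) u + 1) ∧ n ≤ 12 * (n - rpos (cuts n j) u)) := by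
  have hn0 : 0 < n := NeZero.pos n
  have hK : u.2.val < n := ZMod.val_lt _
  have hc : ∀ k : Fin 3, k.val * (n/3) < n := by
    intro k
    fin_cases k <;> simp <;> omega
  unfold cuts
  rw [rpos_cast _ (hc i), rpos_cast _ (hc j)]
  have : (i = 0 ∧ j = 1) ∨ (i = 0 ∧ j = 2) ∨ (i = 1 ∧ j = 2) := by
    revert hij; revert i j; decide
  rcases this with ⟨rfl, rfl⟩ | ⟨rfl, rfl⟩ | ⟨rfl, rfl⟩ <;> simp <;> split_ifs <;> omega

theorem good_cut [NeZero n] (u v : Lamp n) : ∃ j : Fin 3,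
    (n ≤ 12 * (rpos (cuts n j) u + 1) ∧ n ≤ 12 * (n - rpos (cuts n j) u)) ∧
    (n ≤ 12 * (rpos (cuts n j) v + 1) ∧ n ≤ 12 * (n - rpos (cuts n j) v)) := by
  have u1 := good_one u (show (0 : Fin 3) < 1 by decide)
  have u2 := good_one u (show (0 : Fin 3) < 2 by decide)
  have u3 := good_one u (show (1 : Fin 3) < 2 by decide)
  have v1 := good_one v (show (0 : Fin 3) < 1 by decide)
  have v2 := good_one v (show (0 : Fin 3) < 2 by decide)
  have v3 := good_one v (show (1 : Fin 3) < 2 by decide)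
  by_contra hcon
  push Not at hcon
  have c0 := hcon 0
  have c1 := hcon 1
  have c2 := hcon 2
  omega

theorem FF_bilip [NeZero n] {x : List Bool → X} (hx1 : ∀ w, ‖x w‖ ≤ 1)
    (hx : ∀ p : List Bool, p.length ≤ n+3 → ∃ g : X →L[ℝ] ℝ, ‖g‖ ≤ 1 ∧
      ∀ w : List Bool, w.length ≤ n+3 → |g (x w) - (if p <+: w then (1:ℝ) else 0)| ≤ 1 / (1152 * n))
    (u v : Lamp n) : (1/96:ℝ) * lampDist n u v ≤ ‖FF x (cuts n) u - FF x (cuts n) v‖ ∧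
      ‖FF x (cuts n) u - FF x (cuts n) v‖ ≤ 1152 * (1/96) * lampDist n u v := by
  have hn : (0:ℝ) < n := by exact_mod_cast NeZero.pos n
  have key : ∃ m : ℕ, Wk m u v ∧ (m : ℝ) ≤ 48 * (‖FF x (cuts n) u - FF x (cuts n) v‖ + 12 * n * (1 / (1152 * n))) := by
    obtain ⟨j, hu, hv⟩ := good_cut u v
    rcases le_total (rpos (cuts n j) u) (rpos (cuts n j) v) with h | h
    · exact core_lower (by positivity) hx (cuts n) j u v h hu.1 hv.2
    · obtain ⟨m, h1, h2⟩ := core_lower (by positivity) hx (cuts n) j v u h hv.1 hu.2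
      exact ⟨m, Wk_symm h1, by rwa [norm_sub_rev] at h2⟩
  obtain ⟨m, hm1, hm2⟩ := key
  have e : 12 * (n:ℝ) * (1 / (1152 * n)) = 1/96 := by field_simp; norm_num
  rw [e] at hm2
  have h1 : (lampDist n u v : ℝ) ≤ m := by exact_mod_cast lampDist_le hm1
  constructor
  · rcases Nat.eq_zero_or_pos (lampDist n u v) with h0 | h0
    · rw [h0]; simp
    · have : (1:ℝ) ≤ lampDist n u v := by exact_mod_cast h0
      linarith
  · have := FF_lip hx1 (cuts n) _ (lampDist_wk hm1)
    linarith
end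

/-- Every non-superreflexive Banach space admits, with uniformly bounded distortion,
bilipschitz embeddings of all finite lamplighter groups `Z₂ ≀ Z_n` (with word metric
w.r.t. `{t, ta}`). -/
theorem lamplighters_embed_into_nonsuperreflexive
    (X : Type*) [NormedAddCommGroup X] [NormedSpace ℝ X] [CompleteSpace X]
    (hX : ¬ HasEquivUnifConvexNorm X) :
    ∃ D : ℝ, 1 ≤ D ∧ ∀ n : ℕ, 2 ≤ n →
      ∃ (f : Lamp n → X) (r : ℝ), 0 < r ∧
        ∀ u v : Lamp n,
          r * (lampDist n u v : ℝ) ≤ ‖f u - f v‖ ∧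
          ‖f u - f v‖ ≤ D * r * (lampDist n u v : ℝ) := by
  have hren : ¬ ∀ ε > (0:ℝ), ∃ n, Bder X ε n = ∅ := fun H => hX (renorming H)
  push Not at hren
  obtain ⟨ε, hε, hB⟩ := hren
  refine ⟨1152, by norm_num, ?_⟩
  intro n hn
  haveI : NeZero n := ⟨by omega⟩
  have hn0 : (0:ℝ) < n := by exact_mod_cast (by omega : 0 < n)
  obtain ⟨x, hx1, hx⟩ := tree_system hε hB (n+3) (δ := 1 / (1152 * n)) (by positivity)
  exact ⟨FF x (cuts n), 1/96, by norm_num, fun u v => FF_bilip hx1 hx u v⟩
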